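/- Let p be a nearest-neighbor transition probability function on ℤ (p(x,y) = 0 whenever |x−y| ≠ 1) with inf_{|x−y|=1} p(x,y) > 0, and let π be a reversible measure for p. If the set {π(x) : x > 0} has a limit point in (0,∞) and the set {π(x) : x < 0} has a limit point in (0,∞), then the set of extremal invariant measures for the exclusion process is exactly {ν^c : 0 ≤ c ≤ ∞}. -/

import Mathlib

open MeasureTheory Filter Topology

section Defs

variable {S : Type*}

/-- The configuration obtained from `η` by exchanging the values at sites `x` and `y`. -/
def swapConfig [DecidableEq S] (x y : S) (η : S → Bool) : S → Bool :=
  fun u => if u = x then η y else if u = y then η x else η u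

/-- A cylinder function depends on finitely many coordinates. -/
def IsCylinder (f : (S → Bool) → ℝ) : Prop :=
  ∃ F : Finset S, ∀ η ξ : S → Bool, (∀ x ∈ F, η x = ξ x) → f η = f ξ

/-- The exclusion process generator applied to a cylinder function. -/
noncomputable def exclGen [DecidableEq S] (p : S → S → ℝ) (f : (S → Bool) → ℝ)
    (η : S → Bool) : ℝ :=
  ∑' x : S, ∑' y : S,
    (if η x = true ∧ η y = false then p x y * (f (swapConfig x y η) - f η) else 0)

/-- `p` is a transition probability function with bounded column sums. -/
def IsTransition (p : S → S → ℝ) : Prop :=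
  (∀ x y, 0 ≤ p x y) ∧ (∀ x, HasSum (fun y => p x y) 1) ∧
    ∃ C : ℝ, ∀ (y : S) (F : Finset S), ∑ x ∈ F, p x y ≤ C

/-- A probability measure is invariant for the exclusion process. -/
def ExclInvariant [DecidableEq S] (p : S → S → ℝ) (μ : Measure (S → Bool)) : Prop :=
  IsProbabilityMeasure μ ∧ ∀ f : (S → Bool) → ℝ, IsCylinder f → ∫ η, exclGen p f η ∂μ = 0

/-- Extremal invariant probability measures. -/
def IsExtremalInvariant [DecidableEq S] (p : S → S → ℝ) (μ : Measure (S → Bool)) : Prop :=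
  ExclInvariant p μ ∧ ∀ (t : ℝ) (ν₁ ν₂ : Measure (S → Bool)), 0 < t → t < 1 →
    ExclInvariant p ν₁ → ExclInvariant p ν₂ →
    μ = ENNReal.ofReal t • ν₁ + ENNReal.ofReal (1 - t) • ν₂ → ν₁ = μ ∧ ν₂ = μ

/-- A reversible measure `π` for the kernel `p`. -/
def IsReversible (p : S → S → ℝ) (π : S → ℝ) : Prop :=
  (∀ x, 0 < π x) ∧ ∀ x y, π x * p x y = π y * p y x

/-- Irreducibility of `p`. -/
def IrreducibleKernel (p : S → S → ℝ) : Prop :=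
  ∀ x y : S, x ≠ y → ∃ (n : ℕ) (c : ℕ → S), c 0 = x ∧ c n = y ∧ ∀ i < n, 0 < p (c i) (c (i+1))

/-- `ν` is the product (Bernoulli) measure with marginals `α`. -/
def IsBernoulliProduct (ν : Measure (S → Bool)) (α : S → ℝ) : Prop :=
  IsProbabilityMeasure ν ∧ ∀ (F : Finset S) (a : S → Bool),
    ν {η | ∀ x ∈ F, η x = a x} = ∏ x ∈ F, ENNReal.ofReal (if a x then α x else 1 - α x)

/-- A probability measure is reversible for the exclusion process. -/
def IsReversibleMeasure [DecidableEq S] (p : S → S → ℝ) (μ : Measure (S → Bool)) : Prop :=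
  ∀ f g : (S → Bool) → ℝ, IsCylinder f → IsCylinder g →
    ∫ η, f η * exclGen p g η ∂μ = ∫ η, g η * exclGen p f η ∂μ

end Defs

namespace Exclusion

/-- The cylinder set of configurations agreeing with `a` on `F`. -/
def cyl (F : Finset ℤ) (a : ℤ → Bool) : Set (ℤ → Bool) := {η | ∀ x ∈ F, η x = a x}

/-- `f` depends only on the coordinates in `F`. -/
def DepOn {β : Type*} (F : Finset ℤ) (f : (ℤ → Bool) → β) : Prop :=
  ∀ η ξ : ℤ → Bool, (∀ x ∈ F, η x = ξ x) → f η = f ξ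

/-- Restriction of configurations to `F`. -/
abbrev res (F : Finset ℤ) : (ℤ → Bool) → (F → Bool) := F.restrict (π := fun _ => Bool)

lemma measurable_res (F : Finset ℤ) : Measurable (res F) := Finset.measurable_restrict F

/-- Extend a configuration on `F` by `false`. -/
def extend (F : Finset ℤ) (b : F → Bool) : ℤ → Bool :=
  fun x => if h : x ∈ F then b ⟨x, h⟩ else false

lemma extend_restrict {F : Finset ℤ} (η : ℤ → Bool) {x : ℤ} (hx : x ∈ F) :
    extend F (res F η) x = η x := by
  simp [extend, hx]

lemma DepOn.eq_comp {β : Type*} {F : Finset ℤ} {f : (ℤ → Bool) → β} (hf : DepOn F f)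
    (η : ℤ → Bool) : f (extend F (res F η)) = f η :=
  hf _ _ fun _ hx => extend_restrict η hx

lemma DepOn.mono {β : Type*} {F G : Finset ℤ} {f : (ℤ → Bool) → β} (hf : DepOn F f)
    (h : F ⊆ G) : DepOn G f :=
  fun η ξ hh => hf η ξ fun x hx => hh x (h hx)

lemma DepOn.measurable {F : Finset ℤ} {f : (ℤ → Bool) → ℝ} (hf : DepOn F f) :
    Measurable f := by
  have : f = (fun b : F → Bool => f (extend F b)) ∘ res F := by
    funext η; exact (hf.eq_comp η).symm
  rw [this]
  exact Measurable.of_discrete.comp (measurable_res F)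

lemma DepOn.integrable {F : Finset ℤ} {f : (ℤ → Bool) → ℝ} (hf : DepOn F f)
    (μ : Measure (ℤ → Bool)) [IsFiniteMeasure μ] : Integrable f μ := by
  refine Integrable.of_bound hf.measurable.aestronglyMeasurable
    (∑ b : F → Bool, ‖f (extend F b)‖) (Eventually.of_forall fun η => ?_)
  rw [← hf.eq_comp η]
  exact Finset.single_le_sum (f := fun b : F → Bool => ‖f (extend F b)‖)
    (fun _ _ => norm_nonneg _) (Finset.mem_univ _)

lemma depOn_eval {F : Finset ℤ} {x : ℤ} (hx : x ∈ F) :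
    DepOn F (fun η : ℤ → Bool => η x) := fun _ _ h => h x hx

lemma DepOn.comp {β γ : Type*} {F : Finset ℤ} {f : (ℤ → Bool) → β} (hf : DepOn F f)
    (g : β → γ) : DepOn F (fun η => g (f η)) := fun η ξ h => by simp only [hf η ξ h]

lemma DepOn.comp₂ {β γ κ : Type*} {F : Finset ℤ} {f : (ℤ → Bool) → β} {g : (ℤ → Bool) → γ}
    (hf : DepOn F f) (hg : DepOn F g) (k : β → γ → κ) :
    DepOn F (fun η => k (f η) (g η)) := fun η ξ h => by simp only [hf η ξ h, hg η ξ h]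

lemma measurableSet_cyl (F : Finset ℤ) (a : ℤ → Bool) : MeasurableSet (cyl F a) := by
  have : cyl F a = ⋂ x ∈ F, {η : ℤ → Bool | η x = a x} := by ext; simp [cyl]
  rw [this]
  exact Finset.measurableSet_biInter _ fun x _ =>
    measurableSet_eq_fun (measurable_pi_apply x) measurable_const

lemma cyl_congr {F : Finset ℤ} {a b : ℤ → Bool} (h : ∀ x ∈ F, a x = b x) :
    cyl F a = cyl F b := by
  ext η; simp only [cyl, Set.mem_ofPred_eq]
  exact forall₂_congr fun x hx => by rw [h x hx]

lemma restrict_preimage_singleton (F : Finset ℤ) (b : F → Bool) :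
    res F ⁻¹' {b} = cyl F (extend F b) := by
  ext η
  simp only [Set.mem_preimage, Set.mem_singleton_iff, funext_iff, Subtype.forall, cyl,
    Set.mem_ofPred_eq, Finset.restrict]
  refine forall₂_congr fun x hx => ?_
  simp [extend, hx]

/-- Finite measures agreeing on the cylinder sets over large index sets are equal. -/
lemma ext_of_cyl {μ₁ μ₂ : Measure (ℤ → Bool)} [IsFiniteMeasure μ₁] (F₀ : Finset ℤ)
    (h : ∀ F : Finset ℤ, F₀ ⊆ F → ∀ a, μ₁ (cyl F a) = μ₂ (cyl F a)) : μ₁ = μ₂ := by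
  have key : ∀ F : Finset ℤ, F₀ ⊆ F → μ₁.map (res F) = μ₂.map (res F) := by
    intro F hF
    refine Measure.ext_of_singleton fun b => ?_
    rw [Measure.map_apply (measurable_res F) (measurableSet_singleton b),
      Measure.map_apply (measurable_res F) (measurableSet_singleton b),
      restrict_preimage_singleton]
    exact h F hF _
  have key' : ∀ F : Finset ℤ, μ₁.map (res F) = μ₂.map (res F) := by
    intro F
    have hs : F ⊆ F ∪ F₀ := Finset.subset_union_left
    have e : res F =
      Finset.restrict₂ (π := fun _ => Bool) hs ∘ res (F ∪ F₀) := rfl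
    have hm : Measurable (Finset.restrict₂ (π := fun _ => Bool) hs) :=
      Finset.measurable_restrict₂ hs
    rw [e, ← Measure.map_map hm (measurable_res _), ← Measure.map_map hm (measurable_res _),
      key _ Finset.subset_union_right]
  exact IsProjectiveLimit.unique (P := fun F => μ₁.map (res F)) (fun _ => rfl)
    (fun F => (key' F).symm)

lemma integral_eq_sum {F : Finset ℤ} {f : (ℤ → Bool) → ℝ} (hf : DepOn F f)
    (μ : Measure (ℤ → Bool)) [IsFiniteMeasure μ] :
    ∫ η, f η ∂μ = ∑ b : F → Bool, μ.real (cyl F (extend F b)) * f (extend F b) := by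
  calc ∫ η, f η ∂μ = ∫ η, f (extend F (res F η)) ∂μ := by simp only [hf.eq_comp]
    _ = ∫ b, f (extend F b) ∂(μ.map (res F)) :=
      (integral_map (f := fun b => f (extend F b)) (measurable_res F).aemeasurable
        Measurable.of_discrete.aestronglyMeasurable).symm
    _ = _ := by
      rw [integral_fintype (Integrable.of_finite)]
      refine Finset.sum_congr rfl fun b _ => ?_
      rw [map_measureReal_apply (measurable_res F) (measurableSet_singleton b),
        restrict_preimage_singleton, smul_eq_mul]

/-! ### Exchanging two sites -/

lemma swapConfig_eq (y z : ℤ) (η : ℤ → Bool) :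
    swapConfig y z η = fun u => η (Equiv.swap y z u) := by
  funext u
  simp only [swapConfig, Equiv.swap_apply_def]
  split_ifs <;> rfl

@[simp] lemma swapConfig_swapConfig (y z : ℤ) (η : ℤ → Bool) :
    swapConfig y z (swapConfig y z η) = η := by
  simp [swapConfig_eq]

lemma swapConfig_comm (y z : ℤ) (η : ℤ → Bool) : swapConfig y z η = swapConfig z y η := by
  simp [swapConfig_eq, Equiv.swap_comm]

@[simp] lemma swapConfig_left (y z : ℤ) (η : ℤ → Bool) : swapConfig y z η y = η z := by
  simp [swapConfig]

@[simp] lemma swapConfig_right (y z : ℤ) (η : ℤ → Bool) : swapConfig y z η z = η y := by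
  simp [swapConfig_eq]

lemma swapConfig_of_ne {y z u : ℤ} (h₁ : u ≠ y) (h₂ : u ≠ z) (η : ℤ → Bool) :
    swapConfig y z η u = η u := by
  simp [swapConfig, h₁, h₂]

lemma measurable_swapConfig (y z : ℤ) : Measurable (swapConfig (S := ℤ) y z) := by
  have : swapConfig (S := ℤ) y z = fun η u => η (Equiv.swap y z u) :=
    funext fun η => swapConfig_eq y z η
  rw [this]
  exact measurable_pi_lambda _ fun u => measurable_pi_apply _

lemma DepOn.swap {β : Type*} {F : Finset ℤ} {f : (ℤ → Bool) → β} (hf : DepOn F f) {y z : ℤ}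
    (hy : y ∈ F) (hz : z ∈ F) : DepOn F (fun η => f (swapConfig y z η)) := by
  intro η ξ h
  refine hf _ _ fun u hu => ?_
  simp only [swapConfig]
  split_ifs
  exacts [h z hz, h y hy, h u hu]

lemma DepOn.swap_eq {β : Type*} {F : Finset ℤ} {f : (ℤ → Bool) → β} (hf : DepOn F f) {y z : ℤ}
    (hy : y ∉ F) (hz : z ∉ F) (η : ℤ → Bool) : f (swapConfig y z η) = f η :=
  hf _ _ fun _ hu => swapConfig_of_ne (ne_of_mem_of_not_mem hu hy) (ne_of_mem_of_not_mem hu hz) _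

/-- Configurations with value `b` at `y` and `c` at `z`. -/
def twoSite (y z : ℤ) (b c : Bool) : Set (ℤ → Bool) := {η | η y = b ∧ η z = c}

lemma measurableSet_site (y : ℤ) (b : Bool) : MeasurableSet {η : ℤ → Bool | η y = b} :=
  measurableSet_eq_fun (measurable_pi_apply y) measurable_const

lemma measurableSet_twoSite (y z : ℤ) (b c : Bool) : MeasurableSet (twoSite y z b c) :=
  (measurableSet_site y b).inter (measurableSet_site z c)

lemma depOn_twoSite {F : Finset ℤ} {y z : ℤ} (hy : y ∈ F) (hz : z ∈ F) (b c : Bool) :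
    DepOn F (fun η => η ∈ twoSite y z b c) := by
  intro η ξ h; simp [twoSite, h y hy, h z hz]

lemma DepOn.indicator {F : Finset ℤ} {f : (ℤ → Bool) → ℝ} {s : Set (ℤ → Bool)}
    (hf : DepOn F f) (hs : DepOn F (fun η => η ∈ s)) : DepOn F (s.indicator f) := by
  intro η ξ h
  have h1 : (η ∈ s) = (ξ ∈ s) := hs η ξ h
  by_cases hη : η ∈ s
  · rw [Set.indicator_of_mem hη, Set.indicator_of_mem (h1 ▸ hη), hf η ξ h]
  · rw [Set.indicator_of_notMem hη, Set.indicator_of_notMem (h1 ▸ hη)]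

lemma depOn_cyl (F : Finset ℤ) (a : ℤ → Bool) : DepOn F (fun η => η ∈ cyl F a) := by
  intro η ξ h
  simp only [cyl, Set.mem_ofPred_eq, eq_iff_iff]
  exact forall₂_congr fun x hx => by rw [h x hx]

/-- Detailed balance of `μ` under every exchange of two sites, with respect to `π`. -/
def SwapBal (π : ℤ → ℝ) (μ : Measure (ℤ → Bool)) : Prop :=
  ∀ y z, y ≠ z →
    ENNReal.ofReal (π z) • (μ.restrict (twoSite y z true false)).map (swapConfig y z) =
      ENNReal.ofReal (π y) • μ.restrict (twoSite y z false true)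

lemma SwapBal.apply {π : ℤ → ℝ} {μ : Measure (ℤ → Bool)} (h : SwapBal π μ) {y z : ℤ}
    (hyz : y ≠ z) {C : Set (ℤ → Bool)} (hC : MeasurableSet C) :
    ENNReal.ofReal (π z) * μ (swapConfig y z ⁻¹' C ∩ twoSite y z true false) =
      ENNReal.ofReal (π y) * μ (C ∩ twoSite y z false true) := by
  have := congrArg (fun m : Measure (ℤ → Bool) => m C) (h y z hyz)
  simpa [Measure.map_apply (measurable_swapConfig y z) hC,
    Measure.restrict_apply (measurable_swapConfig y z hC), Measure.restrict_apply hC] using this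

lemma swapBal_of_cyl {π : ℤ → ℝ} {μ : Measure (ℤ → Bool)} [IsFiniteMeasure μ]
    (h : ∀ y z, y ≠ z → ∃ F₀ : Finset ℤ, ∀ F, F₀ ⊆ F → ∀ a,
      ENNReal.ofReal (π z) * μ (swapConfig y z ⁻¹' (cyl F a) ∩ twoSite y z true false) =
      ENNReal.ofReal (π y) * μ (cyl F a ∩ twoSite y z false true)) : SwapBal π μ := by
  intro y z hyz
  obtain ⟨F₀, h⟩ := h y z hyz
  have : IsFiniteMeasure (ENNReal.ofReal (π z) •
      (μ.restrict (twoSite y z true false)).map (swapConfig y z)) :=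
    Measure.smul_finite _ ENNReal.ofReal_ne_top
  refine ext_of_cyl F₀ fun F hF a => ?_
  have hC := measurableSet_cyl F a
  simpa [Measure.map_apply (measurable_swapConfig y z) hC,
    Measure.restrict_apply (measurable_swapConfig y z hC), Measure.restrict_apply hC]
    using h F hF a

lemma SwapBal.integral {π : ℤ → ℝ} (hπ : ∀ x, 0 < π x) {μ : Measure (ℤ → Bool)}
    (h : SwapBal π μ) {y z : ℤ}
    (hyz : y ≠ z) {f : (ℤ → Bool) → ℝ} (hf : Measurable f) :
    π z * ∫ η in twoSite y z true false, f (swapConfig y z η) ∂μ =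
      π y * ∫ η in twoSite y z false true, f η ∂μ := by
  have := congrArg (fun m : Measure (ℤ → Bool) => ∫ η, f η ∂m) (h y z hyz)
  simp only [integral_smul_measure] at this
  rwa [integral_map (measurable_swapConfig y z).aemeasurable hf.aestronglyMeasurable,
    ENNReal.toReal_ofReal (hπ z).le, ENNReal.toReal_ofReal (hπ y).le] at this

/-! ### The generator as a finite sum over bonds -/

/-- The contribution of the bond `{x, x + 1}` to the generator. -/
noncomputable def bond (p : ℤ → ℤ → ℝ) (f : (ℤ → Bool) → ℝ) (x : ℤ) (η : ℤ → Bool) : ℝ :=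
  (twoSite x (x + 1) true false).indicator
      (fun η => p x (x + 1) * (f (swapConfig x (x + 1) η) - f η)) η +
    (twoSite x (x + 1) false true).indicator
      (fun η => p (x + 1) x * (f (swapConfig x (x + 1) η) - f η)) η

lemma DepOn.bond {p : ℤ → ℤ → ℝ} {F : Finset ℤ} {f : (ℤ → Bool) → ℝ} (hf : DepOn F f) {x : ℤ}
    (hx : x ∈ F) (hx' : x + 1 ∈ F) : DepOn F (bond p f x) := by
  have h1 := hf.comp₂ (hf.swap hx hx') fun a b => p x (x + 1) * (b - a)
  have h2 := hf.comp₂ (hf.swap hx hx') fun a b => p (x + 1) x * (b - a)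
  exact (h1.indicator (depOn_twoSite hx hx' _ _)).comp₂
    (h2.indicator (depOn_twoSite hx hx' _ _)) (· + ·)

lemma exclGen_eq_sum_bond {p : ℤ → ℤ → ℝ} (hnn : ∀ x y : ℤ, |x - y| ≠ 1 → p x y = 0)
    {l r : ℤ} {f : (ℤ → Bool) → ℝ} (hf : DepOn (Finset.Icc l r) f) (η : ℤ → Bool) :
    exclGen p f η = ∑ x ∈ Finset.Ico (l - 1) (r + 1), bond p f x η := by
  set T : ℤ → ℤ → ℝ := fun x y =>
    if η x = true ∧ η y = false then p x y * (f (swapConfig x y η) - f η) else 0 with hT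
  have hout : ∀ x, x ∉ Finset.Ico (l - 1) (r + 1) → T x (x + 1) = 0 ∧ T (x + 1) x = 0 := by
    intro x hx
    have h1 : x ∉ Finset.Icc l r := by simp only [Finset.mem_Ico, Finset.mem_Icc] at *; omega
    have h2 : x + 1 ∉ Finset.Icc l r := by
      simp only [Finset.mem_Ico, Finset.mem_Icc] at *; omega
    simp [hT, hf.swap_eq h1 h2, hf.swap_eq h2 h1]
  have hin : ∀ x, ∑' y, T x y = T x (x + 1) + T x (x - 1) := by
    intro x
    have hne : x + 1 ≠ x - 1 := by omega
    rw [tsum_eq_sum (s := {x + 1, x - 1}), Finset.sum_pair hne]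
    intro y hy
    simp only [Finset.mem_insert, Finset.mem_singleton, not_or] at hy
    have : p x y = 0 := hnn x y fun h => by
      rcases (abs_eq (zero_le_one' ℤ)).1 h with h | h <;> omega
    simp [hT, this]
  have h1 : HasSum (fun x => T x (x + 1)) (∑ x ∈ Finset.Ico (l - 1) (r + 1), T x (x + 1)) :=
    hasSum_sum_of_ne_finset_zero fun x hx => (hout x hx).1
  have h2 : HasSum (fun x => T x (x - 1)) (∑ x ∈ Finset.Ico (l - 1) (r + 1), T (x + 1) x) := by
    have : HasSum (fun x => T (x + 1) x) (∑ x ∈ Finset.Ico (l - 1) (r + 1), T (x + 1) x) :=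
      hasSum_sum_of_ne_finset_zero fun x hx => (hout x hx).2
    rw [← (Equiv.addRight (1 : ℤ)).hasSum_iff]
    simpa [Function.comp_def] using this
  have h3 : exclGen p f η = ∑' x, (T x (x + 1) + T x (x - 1)) := by
    simp only [← hin]; rfl
  rw [h3, (h1.add h2).tsum_eq, ← Finset.sum_add_distrib]
  refine Finset.sum_congr rfl fun x _ => ?_
  simp only [hT, bond, Set.indicator_apply, twoSite, Set.mem_ofPred_eq, swapConfig_comm (x + 1) x,
    and_comm (a := η (x + 1) = true)]

lemma exists_Icc (F : Finset ℤ) : ∃ n : ℤ, ∀ l r, l ≤ -n → n ≤ r → F ⊆ Finset.Icc l r := by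
  refine ⟨∑ x ∈ F, |x|, fun l r hl hr x hx => ?_⟩
  have := Finset.single_le_sum (f := fun x : ℤ => |x|) (fun _ _ => abs_nonneg _) hx
  have h := abs_le.1 this
  exact Finset.mem_Icc.2 ⟨by linarith [h.1], by linarith [h.2]⟩

lemma integral_bond {p : ℤ → ℤ → ℝ} (μ : Measure (ℤ → Bool)) [IsFiniteMeasure μ] {F : Finset ℤ}
    {f : (ℤ → Bool) → ℝ} (hf : DepOn F f) {x : ℤ} (hx : x ∈ F) (hx' : x + 1 ∈ F) :
    ∫ η, bond p f x η ∂μ =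
      p x (x + 1) * (∫ η in twoSite x (x + 1) true false, (f (swapConfig x (x + 1) η) - f η) ∂μ) +
      p (x + 1) x *
        (∫ η in twoSite x (x + 1) false true, (f (swapConfig x (x + 1) η) - f η) ∂μ) := by
  have h1 := hf.comp₂ (hf.swap hx hx') fun a b => p x (x + 1) * (b - a)
  have h2 := hf.comp₂ (hf.swap hx hx') fun a b => p (x + 1) x * (b - a)
  unfold bond
  rw [integral_add (h1.indicator (depOn_twoSite hx hx' _ _) |>.integrable μ)
    (h2.indicator (depOn_twoSite hx hx' _ _) |>.integrable μ),
    integral_indicator (measurableSet_twoSite _ _ _ _),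
    integral_indicator (measurableSet_twoSite _ _ _ _), integral_const_mul, integral_const_mul]

section Balance

variable {p : ℤ → ℤ → ℝ} {π : ℤ → ℝ}

lemma SwapBal.bond_flip (hπ : ∀ x, 0 < π x)
    (hbal : ∀ x y, π x * p x y = π y * p y x) {ν : Measure (ℤ → Bool)}
    (hν : SwapBal π ν) (x : ℤ) {f : (ℤ → Bool) → ℝ} (hf : Measurable f) :
    p x (x + 1) * ∫ η in twoSite x (x + 1) true false, f (swapConfig x (x + 1) η) ∂ν =
      p (x + 1) x * ∫ η in twoSite x (x + 1) false true, f η ∂ν := by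
  have h := hν.integral hπ (show x ≠ x + 1 by omega) hf
  have h1 := hπ x
  have h2 := hπ (x + 1)
  have h3 := hbal x (x + 1)
  have : p (x + 1) x = π x * p x (x + 1) / π (x + 1) := by field_simp; linarith
  rw [this]
  field_simp
  linear_combination p x (x + 1) * h

lemma SwapBal.exclInvariant (hnn : ∀ x y : ℤ, |x - y| ≠ 1 → p x y = 0) (hπ : ∀ x, 0 < π x)
    (hbal : ∀ x y, π x * p x y = π y * p y x) {μ : Measure (ℤ → Bool)}
    [IsProbabilityMeasure μ] (hμ : SwapBal π μ) : ExclInvariant p μ := by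
  refine ⟨inferInstance, fun f ⟨F, hF⟩ => ?_⟩
  obtain ⟨n, hn⟩ := exists_Icc F
  have hf : DepOn (Finset.Icc (-n) n) f := DepOn.mono hF (hn _ _ le_rfl le_rfl)
  simp only [exclGen_eq_sum_bond hnn hf]
  have hb : ∀ x, DepOn (insert x (insert (x + 1) (Finset.Icc (-n) n))) f := fun x =>
    hf.mono fun u hu => by simp [Finset.mem_Icc.1 hu]
  rw [integral_finsetSum _ fun x _ => ((hb x).bond (by simp) (by simp)).integrable μ]
  refine Finset.sum_eq_zero fun x _ => ?_
  rw [integral_bond μ (hb x) (by simp) (by simp)]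
  have h1 := hμ.bond_flip hπ hbal x (f := fun η => f (swapConfig x (x + 1) η) - f η)
    (((hb x).comp₂ ((hb x).swap (by simp) (by simp)) fun a b => b - a).measurable)
  rw [← h1, ← mul_add, ← integral_add]
  · simp
  · exact ((hb x).comp₂ ((hb x).swap (by simp) (by simp)) fun a b => b - a).integrable _
  · simp only [swapConfig_swapConfig]
    exact ((hb x).comp₂ ((hb x).swap (by simp) (by simp)) fun a b => a - b).integrable _

/-! ### Densities on finite boxes -/

/-- The density of `M` with respect to `ν` on the coordinates in `F`. -/
noncomputable def dens (M ν : Measure (ℤ → Bool)) (F : Finset ℤ) (η : ℤ → Bool) : ℝ :=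
  M.real (cyl F η) / ν.real (cyl F η)

lemma depOn_dens (M ν : Measure (ℤ → Bool)) (F : Finset ℤ) : DepOn F (dens M ν F) := by
  intro η ξ h; simp only [dens, cyl_congr h]

variable {M ν : Measure (ℤ → Bool)} [IsFiniteMeasure M] [IsFiniteMeasure ν]

lemma integral_mul_dens (hpos : ∀ F a, 0 < ν.real (cyl F a)) {F : Finset ℤ}
    {h : (ℤ → Bool) → ℝ} (hh : DepOn F h) :
    ∫ η, h η * dens M ν F η ∂ν = ∫ η, h η ∂M := by
  rw [integral_eq_sum (hh.comp₂ (depOn_dens M ν F) (· * ·)), integral_eq_sum hh]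
  refine Finset.sum_congr rfl fun b _ => ?_
  have := hpos F (extend F b)
  simp only [dens]
  field_simp

lemma setIntegral_mul_dens (hpos : ∀ F a, 0 < ν.real (cyl F a)) {F : Finset ℤ}
    {h : (ℤ → Bool) → ℝ} (hh : DepOn F h) {y z : ℤ} (hy : y ∈ F) (hz : z ∈ F) (b c : Bool) :
    ∫ η in twoSite y z b c, h η * dens M ν F η ∂ν = ∫ η in twoSite y z b c, h η ∂M := by
  rw [← integral_indicator (measurableSet_twoSite _ _ _ _),
    ← integral_indicator (measurableSet_twoSite _ _ _ _),
    ← integral_mul_dens hpos (hh.indicator (depOn_twoSite hy hz b c))]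
  refine integral_congr_ae (Eventually.of_forall fun η => ?_)
  by_cases hη : η ∈ twoSite y z b c <;> simp [hη]

/-- The bilinear exchange form on the bond `{x, x + 1}`. -/
noncomputable def exForm (p : ℤ → ℤ → ℝ) (ν : Measure (ℤ → Bool)) (x : ℤ)
    (F f : (ℤ → Bool) → ℝ) : ℝ :=
  p x (x + 1) * ∫ η in twoSite x (x + 1) true false,
    (F η - F (swapConfig x (x + 1) η)) * (f η - f (swapConfig x (x + 1) η)) ∂ν

lemma integral_bond_eq_exForm (hπ : ∀ x, 0 < π x) (hbal : ∀ x y, π x * p x y = π y * p y x)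
    (hν : SwapBal π ν) (hpos : ∀ F a, 0 < ν.real (cyl F a)) {F : Finset ℤ}
    {f : (ℤ → Bool) → ℝ} (hf : DepOn F f) {x : ℤ} (hx : x ∈ F) (hx' : x + 1 ∈ F) :
    ∫ η, bond p f x η ∂M = - exForm p ν x (dens M ν F) f := by
  have hd := depOn_dens M ν F
  have hg := hf.comp₂ (hf.swap hx hx') fun a b => b - a
  rw [integral_bond M hf hx hx', ← setIntegral_mul_dens hpos hg hx hx',
    ← setIntegral_mul_dens hpos hg hx hx',
    ← hν.bond_flip hπ hbal x (f := fun η => (f (swapConfig x (x + 1) η) - f η) * dens M ν F η)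
      (hg.comp₂ hd (· * ·)).measurable, ← mul_add, ← integral_add, exForm, ← mul_neg,
    ← integral_neg]
  · congr 1
    refine integral_congr_ae (Eventually.of_forall fun η => ?_)
    simp only [swapConfig_swapConfig]
    ring
  · exact (hg.comp₂ hd (· * ·)).integrable _
  · exact ((hg.comp₂ hd (· * ·)).swap hx hx').integrable _

end Balance

/-! ### Entropy production -/

lemma sub_mul_log_sub_nonneg {A B : ℝ} (hA : 0 < A) (hB : 0 < B) :
    0 ≤ (A - B) * (Real.log A - Real.log B) := by
  rcases le_total A B with h | h
  · exact mul_nonneg_of_nonpos_of_nonpos (by linarith)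
      (by linarith [Real.log_le_log hA h])
  · exact mul_nonneg (by linarith) (by linarith [Real.log_le_log hB h])

lemma eq_of_sub_mul_log_sub_eq_zero {A B : ℝ} (hA : 0 < A) (hB : 0 < B)
    (h : (A - B) * (Real.log A - Real.log B) = 0) : A = B := by
  rcases mul_eq_zero.1 h with h | h
  · linarith
  · exact Real.log_injOn_pos hA hB (by linarith)

/-- Tangent plane inequality for the convex function `(a - b) (log a - log b)`. -/
lemma tangent_le {A B U V : ℝ} (hA : 0 < A) (hB : 0 < B) (hU : 0 < U) (hV : 0 < V) :
    (Real.log U - Real.log V + 1 - V / U) * A + (Real.log V - Real.log U + 1 - U / V) * B ≤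
      (A - B) * (Real.log A - Real.log B) := by
  have key : ∀ {a b u v : ℝ}, 0 < a → 0 < b → 0 < u → 0 < v →
      (Real.log u - Real.log v + 1) * a - u / v * b ≤ a * (Real.log a - Real.log b) := by
    intro a b u v ha hb hu hv
    have h := Real.log_le_sub_one_of_pos (show 0 < u * b / (v * a) by positivity)
    rw [Real.log_div (by positivity) (by positivity), Real.log_mul hu.ne' hb.ne',
      Real.log_mul hv.ne' ha.ne'] at h
    have h2 := mul_le_mul_of_nonneg_left h ha.le
    have h3 : a * (u * b / (v * a) - 1) = u / v * b - a := by field_simp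
    rw [h3] at h2
    linarith
  have h1 := key hA hB hU hV
  have h2 := key hB hA hV hU
  linarith

lemma log_sub_le_log_div {A U V κ : ℝ} (hA : 0 < A) (hV : 0 < V) (hκ : 0 < κ)
    (h : κ * A ≤ U) : Real.log V - Real.log U ≤ Real.log (V / (κ * A)) := by
  rw [Real.log_div hV.ne' (by positivity)]
  linarith [Real.log_le_log (by positivity) h]

lemma flux_le_of_le {A B U V κ s : ℝ} (hA : 0 < A) (hB : 0 < B) (hV : 0 < V)
    (hκ : 0 < κ) (hs : 0 < s) (h : κ * A ≤ U) (hBA : B ≤ A) :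
    -((A - B) * (Real.log U - Real.log V)) ≤
      s * ((A - B) * (Real.log A - Real.log B)) + 1 / (κ * s) * V := by
  set Y := Real.log (V / (κ * A)) with hY
  have h1 : Real.log V - Real.log U ≤ Y := log_sub_le_log_div hA hV hκ h
  have h2 : -((A - B) * (Real.log U - Real.log V)) ≤ (A - B) * Y := by
    nlinarith [mul_le_mul_of_nonneg_left h1 (sub_nonneg.2 hBA)]
  refine h2.trans ?_
  have h3 := sub_mul_log_sub_nonneg hA hB
  have h4 : 0 < 1 / (κ * s) * V := by positivity
  rcases le_or_gt Y 0 with hY0 | hY0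
  · have := mul_nonneg (sub_nonneg.2 hBA) (neg_nonneg.2 hY0)
    nlinarith [mul_nonneg hs.le h3]
  · have ht : 0 < V / (κ * A) := by positivity
    have h5 : Y ≤ 2 * √(V / (κ * A)) := by
      have e : Y = 2 * Real.log (√(V / (κ * A))) := by
        rw [Real.log_sqrt ht.le, hY]; ring
      have := Real.log_le_sub_one_of_pos (Real.sqrt_pos.2 ht)
      linarith
    have h6 : Y ^ 2 ≤ 4 * (V / (κ * A)) := by
      calc Y ^ 2 ≤ (2 * √(V / (κ * A))) ^ 2 := pow_le_pow_left₀ hY0.le h5 2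
        _ = _ := by rw [mul_pow, Real.sq_sqrt ht.le]; norm_num
    have h7 : A * Y ^ 2 / (4 * s) ≤ 1 / (κ * s) * V := by
      calc A * Y ^ 2 / (4 * s) ≤ A * (4 * (V / (κ * A))) / (4 * s) := by gcongr
        _ = _ := by field_simp
    have h8 : (A - B) ^ 2 / A ≤ (A - B) * (Real.log A - Real.log B) := by
      have h := Real.log_le_sub_one_of_pos (show 0 < B / A by positivity)
      rw [Real.log_div hB.ne' hA.ne'] at h
      have : (A - B) ^ 2 / A = (A - B) * (1 - B / A) := by field_simp
      rw [this]
      exact mul_le_mul_of_nonneg_left (by linarith) (by linarith)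
    have h9 : (A - B) * Y ≤ s * ((A - B) ^ 2 / A) + A * Y ^ 2 / (4 * s) := by
      have e : s * ((A - B) ^ 2 / A) + A * Y ^ 2 / (4 * s) - (A - B) * Y =
          (2 * s * (A - B) - A * Y) ^ 2 / (4 * s * A) := by field_simp; ring
      have : 0 ≤ (2 * s * (A - B) - A * Y) ^ 2 / (4 * s * A) := by positivity
      linarith
    have := mul_le_mul_of_nonneg_left h8 hs.le
    linarith

lemma flux_le {A B U V κ s : ℝ} (hA : 0 < A) (hB : 0 < B) (hU : 0 < U) (hV : 0 < V)
    (hκ : 0 < κ) (hs : 0 < s) (h : κ * A ≤ U) (h' : κ * B ≤ V) :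
    -((A - B) * (Real.log U - Real.log V)) ≤
      s * ((A - B) * (Real.log A - Real.log B)) + 1 / (κ * s) * (U + V) := by
  have hc : 0 < 1 / (κ * s) := by positivity
  rcases le_total B A with hBA | hBA
  · have := flux_le_of_le hA hB hV hκ hs h hBA
    nlinarith [mul_pos hc hU]
  · have := flux_le_of_le hB hA hU hκ hs h' hBA
    nlinarith [mul_pos hc hV]

lemma flux_le_const {A B U V κ : ℝ} (hA : 0 < A) (hB : 0 < B) (hU : 0 < U) (hV : 0 < V)
    (hκ : 0 < κ) (h : κ * A ≤ U) (h' : κ * B ≤ V) :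
    -((A - B) * (Real.log U - Real.log V)) ≤ 1 / κ * (U + V) := by
  have key : ∀ {A B U V : ℝ}, 0 < A → 0 < B → 0 < U → 0 < V → κ * A ≤ U → B ≤ A →
      -((A - B) * (Real.log U - Real.log V)) ≤ 1 / κ * V := by
    intro A B U V hA hB hU hV h hBA
    have h1 := log_sub_le_log_div hA hV hκ h
    have ht : 0 < V / (κ * A) := by positivity
    have h2 : Real.log (V / (κ * A)) ≤ V / (κ * A) := by
      linarith [Real.log_le_sub_one_of_pos ht]
    calc -((A - B) * (Real.log U - Real.log V)) = (A - B) * (Real.log V - Real.log U) := by ring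
      _ ≤ (A - B) * (V / (κ * A)) := mul_le_mul_of_nonneg_left (by linarith) (by linarith)
      _ ≤ A * (V / (κ * A)) := mul_le_mul_of_nonneg_right (by linarith) ht.le
      _ = 1 / κ * V := by field_simp
  have hc : 0 < 1 / κ := by positivity
  rcases le_total B A with hBA | hBA
  · have := key hA hB hU hV h hBA
    nlinarith [mul_pos hc hU]
  · have := key hB hA hV hU h' hBA
    nlinarith [mul_pos hc hV]

lemma DepOn.eq_zero_of_integral_eq_zero {ν : Measure (ℤ → Bool)} [IsFiniteMeasure ν]
    (hpos : ∀ F a, 0 < ν.real (cyl F a)) {F : Finset ℤ} {f : (ℤ → Bool) → ℝ} (hf : DepOn F f)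
    (h0 : ∀ η, 0 ≤ f η) (h : ∫ η, f η ∂ν = 0) (η : ℤ → Bool) : f η = 0 := by
  rw [integral_eq_sum hf, Finset.sum_eq_zero_iff_of_nonneg fun b _ =>
    mul_nonneg measureReal_nonneg (h0 _)] at h
  have := h (res F η) (Finset.mem_univ _)
  rw [hf.eq_comp] at this
  exact (mul_eq_zero.1 this).resolve_left (hpos _ _).ne'

section Production

variable {p : ℤ → ℤ → ℝ} {π : ℤ → ℝ} {M ν : Measure (ℤ → Bool)}

/-- Entropy production of the bond `{x, x + 1}` for the marginal of `M` on `F`. -/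
noncomputable def prodn (p : ℤ → ℤ → ℝ) (M ν : Measure (ℤ → Bool)) (x : ℤ) (F : Finset ℤ) : ℝ :=
  exForm p ν x (dens M ν F) (fun η => Real.log (dens M ν F η))

lemma dens_pos (hM : ∀ F a, 0 < M.real (cyl F a)) (hpos : ∀ F a, 0 < ν.real (cyl F a))
    (F : Finset ℤ) (η : ℤ → Bool) : 0 < dens M ν F η :=
  div_pos (hM _ _) (hpos _ _)

lemma prodn_nonneg (hp : ∀ x y, 0 ≤ p x y)
    (hM : ∀ F a, 0 < M.real (cyl F a)) (hpos : ∀ F a, 0 < ν.real (cyl F a)) (x : ℤ)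
    (F : Finset ℤ) : 0 ≤ prodn p M ν x F :=
  mul_nonneg (hp _ _) (integral_nonneg fun _ =>
    sub_mul_log_sub_nonneg (dens_pos hM hpos _ _) (dens_pos hM hpos _ _))

variable [IsFiniteMeasure M] [IsFiniteMeasure ν]

lemma prodn_mono (hp : ∀ x y, 0 ≤ p x y) (hπ : ∀ x, 0 < π x)
    (hbal : ∀ x y, π x * p x y = π y * p y x) (hν : SwapBal π ν)
    (hM : ∀ F a, 0 < M.real (cyl F a)) (hpos : ∀ F a, 0 < ν.real (cyl F a))
    {F G : Finset ℤ} (hFG : F ⊆ G) {x : ℤ} (hx : x ∈ F) (hx' : x + 1 ∈ F) :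
    prodn p M ν x F ≤ prodn p M ν x G := by
  have dF := depOn_dens M ν F
  have dG := depOn_dens M ν G
  have dF' := dF.swap hx hx'
  have dG' := dG.swap (hFG hx) (hFG hx')
  let u : ℝ → ℝ → ℝ := fun a b => Real.log a - Real.log b + 1 - b / a
  have du : DepOn F (fun η => u (dens M ν F η) (dens M ν F (swapConfig x (x + 1) η))) :=
    dF.comp₂ dF' u
  have du' : DepOn F (fun η => u (dens M ν F (swapConfig x (x + 1) η)) (dens M ν F η)) :=
    dF'.comp₂ dF u
  have e1 : ∫ η in twoSite x (x + 1) true false,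
      u (dens M ν F η) (dens M ν F (swapConfig x (x + 1) η)) * dens M ν G η ∂ν =
      ∫ η in twoSite x (x + 1) true false,
      u (dens M ν F η) (dens M ν F (swapConfig x (x + 1) η)) * dens M ν F η ∂ν := by
    rw [setIntegral_mul_dens hpos du hx hx',
      setIntegral_mul_dens hpos (du.mono hFG) (hFG hx) (hFG hx')]
  have e2 : p x (x + 1) * ∫ η in twoSite x (x + 1) true false,
      u (dens M ν F (swapConfig x (x + 1) η)) (dens M ν F η) *
        dens M ν G (swapConfig x (x + 1) η) ∂ν =
      p x (x + 1) * ∫ η in twoSite x (x + 1) true false,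
      u (dens M ν F (swapConfig x (x + 1) η)) (dens M ν F η) *
        dens M ν F (swapConfig x (x + 1) η) ∂ν := by
    have h1 := hν.bond_flip hπ hbal x (f := fun η =>
      u (dens M ν F η) (dens M ν F (swapConfig x (x + 1) η)) * dens M ν G η)
      (((du.mono hFG).comp₂ dG (· * ·)).measurable)
    have h2 := hν.bond_flip hπ hbal x (f := fun η =>
      u (dens M ν F η) (dens M ν F (swapConfig x (x + 1) η)) * dens M ν F η)
      ((du.comp₂ dF (· * ·)).measurable)
    simp only [swapConfig_swapConfig] at h1 h2
    rw [h1, h2, setIntegral_mul_dens hpos du hx hx',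
      setIntegral_mul_dens hpos (du.mono hFG) (hFG hx) (hFG hx')]
  calc prodn p M ν x F
      = p x (x + 1) * ∫ η in twoSite x (x + 1) true false,
        (u (dens M ν F η) (dens M ν F (swapConfig x (x + 1) η)) * dens M ν F η +
        u (dens M ν F (swapConfig x (x + 1) η)) (dens M ν F η) *
        dens M ν F (swapConfig x (x + 1) η)) ∂ν := by
        unfold prodn exForm
        congr 1
        refine integral_congr_ae (Eventually.of_forall fun η => ?_)
        have h1 := dens_pos hM hpos F η
        have h2 := dens_pos hM hpos F (swapConfig x (x + 1) η)
        simp only [u]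
        field_simp
        ring
    _ = p x (x + 1) * ∫ η in twoSite x (x + 1) true false,
        (u (dens M ν F η) (dens M ν F (swapConfig x (x + 1) η)) * dens M ν G η +
        u (dens M ν F (swapConfig x (x + 1) η)) (dens M ν F η) *
        dens M ν G (swapConfig x (x + 1) η)) ∂ν := by
        rw [integral_add, integral_add, mul_add, mul_add, e1, e2]
        · exact ((du.mono hFG).comp₂ dG (· * ·)).integrable _
        · exact ((du'.mono hFG).comp₂ dG' (· * ·)).integrable _
        · exact (du.comp₂ dF (· * ·)).integrable _
        · exact (du'.comp₂ dF' (· * ·)).integrable _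
    _ ≤ prodn p M ν x G := by
        unfold prodn exForm
        refine mul_le_mul_of_nonneg_left (integral_mono ?_ ?_ fun η => ?_) (hp _ _)
        · exact (((du.mono hFG).comp₂ dG (· * ·)).comp₂
            ((du'.mono hFG).comp₂ dG' (· * ·)) (· + ·)).integrable _
        · exact (dG.comp₂ dG' fun a b => (a - b) * (Real.log a - Real.log b)).integrable _
        · exact tangent_le (dens_pos hM hpos _ _) (dens_pos hM hpos _ _)
            (dens_pos hM hpos _ _) (dens_pos hM hpos _ _)

lemma setIntegral_dens_le (hM : ∀ F a, 0 < M.real (cyl F a))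
    (hpos : ∀ F a, 0 < ν.real (cyl F a)) (F : Finset ℤ) (s : Set (ℤ → Bool)) :
    ∫ η in s, dens M ν F η ∂ν ≤ M.real Set.univ := by
  have h := integral_mul_dens (M := M) hpos (F := F) (h := fun _ => 1) (fun _ _ _ => rfl)
  simp only [one_mul, integral_const, smul_eq_mul, mul_one] at h
  rw [← h]
  exact setIntegral_le_integral ((depOn_dens M ν F).integrable ν)
    (Eventually.of_forall fun η => (dens_pos hM hpos F η).le)

lemma neg_exForm_le (hp : ∀ x y, 0 ≤ p x y) (hp1 : ∀ x y, p x y ≤ 1) (hπ : ∀ x, 0 < π x)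
    (hbal : ∀ x y, π x * p x y = π y * p y x) (hν : SwapBal π ν)
    (hM : ∀ F a, 0 < M.real (cyl F a)) (hpos : ∀ F a, 0 < ν.real (cyl F a))
    {F G : Finset ℤ} (hFG : F ⊆ G) {x : ℤ} (hx : x ∈ G) (hx' : x + 1 ∈ G) {s K : ℝ}
    (hK : 0 ≤ K)
    (hpw : ∀ η, -((dens M ν G η - dens M ν G (swapConfig x (x + 1) η)) *
        (Real.log (dens M ν F η) - Real.log (dens M ν F (swapConfig x (x + 1) η)))) ≤
      s * ((dens M ν G η - dens M ν G (swapConfig x (x + 1) η)) *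
        (Real.log (dens M ν G η) - Real.log (dens M ν G (swapConfig x (x + 1) η)))) +
      K * (dens M ν F η + dens M ν F (swapConfig x (x + 1) η))) :
    -exForm p ν x (dens M ν G) (fun η => Real.log (dens M ν F η)) ≤
      s * prodn p M ν x G + 2 * K * M.real Set.univ := by
  have dF := (depOn_dens M ν F).mono hFG
  have dG := depOn_dens M ν G
  have dF' := dF.swap hx hx'
  have dG' := dG.swap hx hx'
  have hm : 0 ≤ M.real Set.univ := measureReal_nonneg
  have b1 : p x (x + 1) * ∫ η in twoSite x (x + 1) true false, dens M ν F η ∂ν ≤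
      M.real Set.univ := by
    have := setIntegral_dens_le hM hpos F (twoSite x (x + 1) true false)
    have := mul_le_mul_of_nonneg_left this (hp x (x + 1))
    nlinarith [hp1 x (x + 1)]
  have b2 : p x (x + 1) * ∫ η in twoSite x (x + 1) true false,
      dens M ν F (swapConfig x (x + 1) η) ∂ν ≤ M.real Set.univ := by
    rw [hν.bond_flip hπ hbal x dF.measurable]
    have := setIntegral_dens_le hM hpos F (twoSite x (x + 1) false true)
    have := mul_le_mul_of_nonneg_left this (hp (x + 1) x)
    nlinarith [hp1 (x + 1) x]
  have iD := (dG.comp₂ dG' fun a b => (a - b) * (Real.log a - Real.log b)).integrable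
    (ν.restrict (twoSite x (x + 1) true false))
  have i1 := dF.integrable (ν.restrict (twoSite x (x + 1) true false))
  have i2 := dF'.integrable (ν.restrict (twoSite x (x + 1) true false))
  have i3 : Integrable (fun η => K * (dens M ν F η + dens M ν F (swapConfig x (x + 1) η)))
    (ν.restrict (twoSite x (x + 1) true false)) := (i1.add i2).const_mul K
  calc -exForm p ν x (dens M ν G) (fun η => Real.log (dens M ν F η))
      = p x (x + 1) * ∫ η in twoSite x (x + 1) true false,
        -((dens M ν G η - dens M ν G (swapConfig x (x + 1) η)) *
        (Real.log (dens M ν F η) - Real.log (dens M ν F (swapConfig x (x + 1) η)))) ∂ν := by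
        rw [integral_neg, mul_neg]; rfl
    _ ≤ p x (x + 1) * ∫ η in twoSite x (x + 1) true false,
      (s * ((dens M ν G η - dens M ν G (swapConfig x (x + 1) η)) *
        (Real.log (dens M ν G η) - Real.log (dens M ν G (swapConfig x (x + 1) η)))) +
      K * (dens M ν F η + dens M ν F (swapConfig x (x + 1) η))) ∂ν := by
        refine mul_le_mul_of_nonneg_left (integral_mono ?_ ?_ hpw) (hp _ _)
        · exact ((dG.comp₂ dG' fun a b => a - b).comp₂
            (dF.comp₂ dF' fun a b => Real.log a - Real.log b) fun a b => -(a * b)).integrable _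
        · exact (iD.const_mul s).add i3
    _ = s * prodn p M ν x G + K * (
        p x (x + 1) * (∫ η in twoSite x (x + 1) true false, dens M ν F η ∂ν) +
        p x (x + 1) * ∫ η in twoSite x (x + 1) true false,
          dens M ν F (swapConfig x (x + 1) η) ∂ν) := by
        rw [integral_add (iD.const_mul s) i3, integral_const_mul,
          integral_const_mul, integral_add i1 i2, prodn, exForm]
        ring
    _ ≤ s * prodn p M ν x G + K * (M.real Set.univ + M.real Set.univ) := by gcongr
    _ = _ := by ring

end Production

section Stationary

variable {p : ℤ → ℤ → ℝ} {π : ℤ → ℝ} {M ν : Measure (ℤ → Bool)}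

/-- Total entropy production inside the box `[l, r]`. -/
noncomputable def energy (p : ℤ → ℤ → ℝ) (M ν : Measure (ℤ → Bool)) (l r : ℤ) : ℝ :=
  ∑ x ∈ Finset.Ico l r, prodn p M ν x (Finset.Icc l r)

variable [IsFiniteMeasure M] [IsFiniteMeasure ν]

lemma Icc_subset_succ (l r : ℤ) : Finset.Icc l r ⊆ Finset.Icc (l - 1) (r + 1) :=
  Finset.Icc_subset_Icc (by omega) (by omega)

lemma sum_Ico_succ {l r : ℤ} (hlr : l ≤ r) (f : ℤ → ℝ) :
    ∑ x ∈ Finset.Ico (l - 1) (r + 1), f x = f (l - 1) + ∑ x ∈ Finset.Ico l r, f x + f r := by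
  have : Finset.Ico (l - 1) (r + 1) = insert (l - 1) (insert r (Finset.Ico l r)) := by
    ext x; simp only [Finset.mem_Ico, Finset.mem_insert]; omega
  rw [this, Finset.sum_insert (by simp; omega), Finset.sum_insert (by simp)]
  ring

lemma energy_eq_flux (hnn : ∀ x y : ℤ, |x - y| ≠ 1 → p x y = 0)
    (hπ : ∀ x, 0 < π x) (hbal : ∀ x y, π x * p x y = π y * p y x) (hν : SwapBal π ν)
    (hpos : ∀ F a, 0 < ν.real (cyl F a))
    (hinv : ∀ f : (ℤ → Bool) → ℝ, IsCylinder f → ∫ η, exclGen p f η ∂M = 0)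
    {l r : ℤ} (hlr : l ≤ r) :
    energy p M ν l r =
      -exForm p ν (l - 1) (dens M ν (Finset.Icc (l - 1) (r + 1)))
        (fun η => Real.log (dens M ν (Finset.Icc l r) η)) +
      -exForm p ν r (dens M ν (Finset.Icc (l - 1) (r + 1)))
        (fun η => Real.log (dens M ν (Finset.Icc l r) η)) := by
  have dF : DepOn (Finset.Icc l r) (fun η => Real.log (dens M ν (Finset.Icc l r) η)) :=
    (depOn_dens M ν _).comp _
  have dG := dF.mono (Icc_subset_succ l r)
  have h := hinv _ ⟨_, dF⟩
  simp only [exclGen_eq_sum_bond hnn dF] at h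
  rw [integral_finsetSum _ fun x hx => (dG.bond
    (by simp only [Finset.mem_Icc, Finset.mem_Ico] at *; omega)
    (by simp only [Finset.mem_Icc, Finset.mem_Ico] at *; omega)).integrable M,
    sum_Ico_succ hlr,
    integral_bond_eq_exForm hπ hbal hν hpos dG (by simp; omega) (by simp; omega),
    integral_bond_eq_exForm hπ hbal hν hpos dG (by simp; omega) (by simp; omega)] at h
  have e : ∑ x ∈ Finset.Ico l r,
      ∫ η, bond p (fun η => Real.log (dens M ν (Finset.Icc l r) η)) x η ∂M =
      -energy p M ν l r := by
    rw [energy, ← Finset.sum_neg_distrib]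
    refine Finset.sum_congr rfl fun x hx => ?_
    rw [Finset.mem_Ico] at hx
    exact integral_bond_eq_exForm hπ hbal hν hpos dF (by simp; omega) (by simp; omega)
  rw [e] at h
  linarith

lemma energy_growth (hp : ∀ x y, 0 ≤ p x y) (hπ : ∀ x, 0 < π x)
    (hbal : ∀ x y, π x * p x y = π y * p y x) (hν : SwapBal π ν)
    (hM : ∀ F a, 0 < M.real (cyl F a)) (hpos : ∀ F a, 0 < ν.real (cyl F a))
    {l r l' r' : ℤ} (hlr : l ≤ r) (hl : l' < l) (hr : r < r') :
    energy p M ν l r + (prodn p M ν (l - 1) (Finset.Icc (l - 1) (r + 1)) +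
      prodn p M ν r (Finset.Icc (l - 1) (r + 1))) ≤ energy p M ν l' r' := by
  have hsub : Finset.Icc (l - 1) (r + 1) ⊆ Finset.Icc l' r' :=
    Finset.Icc_subset_Icc (by omega) (by omega)
  calc _ ≤ prodn p M ν (l - 1) (Finset.Icc l' r') +
        ∑ x ∈ Finset.Ico l r, prodn p M ν x (Finset.Icc l' r') +
        prodn p M ν r (Finset.Icc l' r') := by
        have h1 : energy p M ν l r ≤ ∑ x ∈ Finset.Ico l r, prodn p M ν x (Finset.Icc l' r') := by
          refine Finset.sum_le_sum fun x hx => ?_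
          rw [Finset.mem_Ico] at hx
          exact prodn_mono hp hπ hbal hν hM hpos ((Icc_subset_succ l r).trans hsub)
            (by simp; omega) (by simp; omega)
        have h2 : prodn p M ν (l - 1) (Finset.Icc (l - 1) (r + 1)) ≤
            prodn p M ν (l - 1) (Finset.Icc l' r') :=
          prodn_mono hp hπ hbal hν hM hpos hsub (by simp; omega) (by simp; omega)
        have h3 : prodn p M ν r (Finset.Icc (l - 1) (r + 1)) ≤
            prodn p M ν r (Finset.Icc l' r') :=
          prodn_mono hp hπ hbal hν hM hpos hsub (by simp; omega) (by simp; omega)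
        linarith
    _ = ∑ x ∈ Finset.Ico (l - 1) (r + 1), prodn p M ν x (Finset.Icc l' r') :=
        (sum_Ico_succ hlr fun x => prodn p M ν x (Finset.Icc l' r')).symm
    _ ≤ energy p M ν l' r' :=
        Finset.sum_le_sum_of_subset_of_nonneg
          (Finset.Ico_subset_Ico (by omega) (by omega))
          fun x _ _ => prodn_nonneg hp hM hpos _ _

/-- Boxes whose boundary sites have non-degenerate density under `ν`. -/
def GoodBox (ν : Measure (ℤ → Bool)) (κ : ℝ) (l r : ℤ) : Prop :=
  l ≤ r ∧ ∀ a, κ * ν.real (cyl (Finset.Icc l r) a) ≤ ν.real (cyl (Finset.Icc (l - 1) (r + 1)) a)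

lemma GoodBox.mul_dens_le {κ : ℝ} (hκ : 0 < κ) {l r : ℤ} (h : GoodBox ν κ l r)
    (hpos : ∀ F a, 0 < ν.real (cyl F a)) (η : ℤ → Bool) :
    κ * dens M ν (Finset.Icc (l - 1) (r + 1)) η ≤ dens M ν (Finset.Icc l r) η := by
  have h1 := hpos (Finset.Icc (l - 1) (r + 1)) η
  have h2 := hpos (Finset.Icc l r) η
  have h3 : M.real (cyl (Finset.Icc (l - 1) (r + 1)) η) ≤ M.real (cyl (Finset.Icc l r) η) :=
    measureReal_mono fun ξ hξ x hx => hξ x (Icc_subset_succ l r hx)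
  unfold dens
  rw [← mul_div_assoc, div_le_div_iff₀ h1 h2]
  calc κ * M.real (cyl (Finset.Icc (l - 1) (r + 1)) η) * ν.real (cyl (Finset.Icc l r) η)
      = M.real (cyl (Finset.Icc (l - 1) (r + 1)) η) * (κ * ν.real (cyl (Finset.Icc l r) η)) := by
        ring
    _ ≤ _ := mul_le_mul h3 (h.2 η) (by positivity) measureReal_nonneg

end Stationary

section Stationary

variable {p : ℤ → ℤ → ℝ} {π : ℤ → ℝ} {M ν : Measure (ℤ → Bool)}

section

variable [IsFiniteMeasure M] [IsFiniteMeasure ν]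

lemma GoodBox.energy_le (hp : ∀ x y, 0 ≤ p x y) (hp1 : ∀ x y, p x y ≤ 1)
    (hnn : ∀ x y : ℤ, |x - y| ≠ 1 → p x y = 0)
    (hπ : ∀ x, 0 < π x) (hbal : ∀ x y, π x * p x y = π y * p y x) (hν : SwapBal π ν)
    (hM : ∀ F a, 0 < M.real (cyl F a)) (hpos : ∀ F a, 0 < ν.real (cyl F a))
    (hinv : ∀ f : (ℤ → Bool) → ℝ, IsCylinder f → ∫ η, exclGen p f η ∂M = 0)
    {κ : ℝ} (hκ : 0 < κ) {l r : ℤ} (h : GoodBox ν κ l r) {s : ℝ} (hs : 0 < s) :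
    energy p M ν l r ≤ s * (prodn p M ν (l - 1) (Finset.Icc (l - 1) (r + 1)) +
      prodn p M ν r (Finset.Icc (l - 1) (r + 1))) + 4 * M.real Set.univ / (κ * s) := by
  rw [energy_eq_flux hnn hπ hbal hν hpos hinv h.1]
  have key : ∀ x ∈ Finset.Icc (l - 1) (r + 1), x + 1 ∈ Finset.Icc (l - 1) (r + 1) →
      -exForm p ν x (dens M ν (Finset.Icc (l - 1) (r + 1)))
        (fun η => Real.log (dens M ν (Finset.Icc l r) η)) ≤
      s * prodn p M ν x (Finset.Icc (l - 1) (r + 1)) + 2 * (1 / (κ * s)) * M.real Set.univ :=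
    fun x hx hx' => neg_exForm_le hp hp1 hπ hbal hν hM hpos (Icc_subset_succ l r) hx hx'
      (by positivity) fun η => flux_le (dens_pos hM hpos _ _) (dens_pos hM hpos _ _)
        (dens_pos hM hpos _ _) (dens_pos hM hpos _ _) hκ hs (h.mul_dens_le hκ hpos _)
        (h.mul_dens_le hκ hpos _)
  have hlr := h.1
  have h1 := key (l - 1) (by simp; omega) (by simp; omega)
  have h2 := key r (by simp; omega) (by simp; omega)
  have e : 4 * M.real Set.univ / (κ * s) = 2 * (2 * (1 / (κ * s)) * M.real Set.univ) := by ring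
  linarith

lemma GoodBox.energy_le_const (hp : ∀ x y, 0 ≤ p x y) (hp1 : ∀ x y, p x y ≤ 1)
    (hnn : ∀ x y : ℤ, |x - y| ≠ 1 → p x y = 0)
    (hπ : ∀ x, 0 < π x) (hbal : ∀ x y, π x * p x y = π y * p y x) (hν : SwapBal π ν)
    (hM : ∀ F a, 0 < M.real (cyl F a)) (hpos : ∀ F a, 0 < ν.real (cyl F a))
    (hinv : ∀ f : (ℤ → Bool) → ℝ, IsCylinder f → ∫ η, exclGen p f η ∂M = 0)
    {κ : ℝ} (hκ : 0 < κ) {l r : ℤ} (h : GoodBox ν κ l r) :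
    energy p M ν l r ≤ 4 * M.real Set.univ / κ := by
  rw [energy_eq_flux hnn hπ hbal hν hpos hinv h.1]
  have key : ∀ x ∈ Finset.Icc (l - 1) (r + 1), x + 1 ∈ Finset.Icc (l - 1) (r + 1) →
      -exForm p ν x (dens M ν (Finset.Icc (l - 1) (r + 1)))
        (fun η => Real.log (dens M ν (Finset.Icc l r) η)) ≤
      0 * prodn p M ν x (Finset.Icc (l - 1) (r + 1)) + 2 * (1 / κ) * M.real Set.univ :=
    fun x hx hx' => neg_exForm_le hp hp1 hπ hbal hν hM hpos (Icc_subset_succ l r) hx hx'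
      (by positivity) fun η => by
        rw [zero_mul, zero_add]
        exact flux_le_const (dens_pos hM hpos _ _) (dens_pos hM hpos _ _)
          (dens_pos hM hpos _ _) (dens_pos hM hpos _ _) hκ (h.mul_dens_le hκ hpos _)
          (h.mul_dens_le hκ hpos _)
  have hlr := h.1
  have h1 := key (l - 1) (by simp; omega) (by simp; omega)
  have h2 := key r (by simp; omega) (by simp; omega)
  have e : 4 * M.real Set.univ / κ = 2 * (2 * (1 / κ) * M.real Set.univ) := by ring
  linarith

lemma GoodBox.energy_eq_zero (hp : ∀ x y, 0 ≤ p x y) (hp1 : ∀ x y, p x y ≤ 1)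
    (hnn : ∀ x y : ℤ, |x - y| ≠ 1 → p x y = 0)
    (hπ : ∀ x, 0 < π x) (hbal : ∀ x y, π x * p x y = π y * p y x) (hν : SwapBal π ν)
    (hM : ∀ F a, 0 < M.real (cyl F a)) (hpos : ∀ F a, 0 < ν.real (cyl F a))
    (hinv : ∀ f : (ℤ → Bool) → ℝ, IsCylinder f → ∫ η, exclGen p f η ∂M = 0)
    {κ : ℝ} (hκ : 0 < κ) (hgood : ∀ l r : ℤ, ∃ l' r', l' < l ∧ r < r' ∧ GoodBox ν κ l' r')
    {l r : ℤ} (h : GoodBox ν κ l r) : energy p M ν l r = 0 := by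
  have h0 : 0 ≤ energy p M ν l r := Finset.sum_nonneg fun x _ => prodn_nonneg hp hM hpos _ _
  by_contra hne
  have hε : 0 < energy p M ν l r := lt_of_le_of_ne h0 (Ne.symm hne)
  set ε := energy p M ν l r with hεdef
  set m := M.real Set.univ with hm
  have hm0 : 0 < m := (hM ∅ fun _ => true).trans_le (measureReal_mono (Set.subset_univ _))
  set d := κ * ε ^ 2 / (16 * m) with hd
  have hd0 : 0 < d := by positivity
  have grow : ∀ N : ℕ, ∃ l' r', GoodBox ν κ l' r' ∧ ε + N * d ≤ energy p M ν l' r' := by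
    intro N
    induction N with
    | zero => exact ⟨l, r, h, by simp [hεdef]⟩
    | succ N ih =>
      obtain ⟨l₁, r₁, h₁, hD⟩ := ih
      obtain ⟨l₂, r₂, hl, hr, h₂⟩ := hgood l₁ r₁
      refine ⟨l₂, r₂, h₂, ?_⟩
      have hg := energy_growth hp hπ hbal hν hM hpos h₁.1 hl hr
      set D := energy p M ν l₁ r₁ with hDdef
      have hεD : ε ≤ D := by
        have : 0 ≤ (N : ℝ) * d := by positivity
        linarith
      have hD0 : 0 < D := hε.trans_le hεD
      have he := h₁.energy_le hp hp1 hnn hπ hbal hν hM hpos hinv hκ (s := 8 * m / (κ * D))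
        (by positivity)
      rw [← hDdef, ← hm] at he
      set e := prodn p M ν (l₁ - 1) (Finset.Icc (l₁ - 1) (r₁ + 1)) +
        prodn p M ν r₁ (Finset.Icc (l₁ - 1) (r₁ + 1))
      have h3 : 4 * m / (κ * (8 * m / (κ * D))) = D / 2 := by field_simp; norm_num
      rw [h3] at he
      have h4 : κ * D ^ 2 / (16 * m) ≤ e := by
        have h5 : 8 * m / (κ * D) * (κ * D ^ 2 / (16 * m)) = D / 2 := by field_simp; norm_num
        have h6 : 0 < 8 * m / (κ * D) := by positivity
        refine le_of_mul_le_mul_left ?_ h6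
        linarith
      have h7 : d ≤ κ * D ^ 2 / (16 * m) := by rw [hd]; gcongr
      push_cast
      linarith
  obtain ⟨N, hN⟩ := exists_nat_gt (4 * m / κ / d)
  obtain ⟨l', r', h', hl'⟩ := grow N
  have := h'.energy_le_const hp hp1 hnn hπ hbal hν hM hpos hinv hκ
  rw [div_lt_iff₀ hd0] at hN
  linarith

lemma GoodBox.dens_swap_succ (hp : ∀ x y, 0 ≤ p x y) (hp1 : ∀ x y, p x y ≤ 1)
    (hnn : ∀ x y : ℤ, |x - y| ≠ 1 → p x y = 0) (hpp : ∀ x, 0 < p x (x + 1))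
    (hπ : ∀ x, 0 < π x) (hbal : ∀ x y, π x * p x y = π y * p y x) (hν : SwapBal π ν)
    (hM : ∀ F a, 0 < M.real (cyl F a)) (hpos : ∀ F a, 0 < ν.real (cyl F a))
    (hinv : ∀ f : (ℤ → Bool) → ℝ, IsCylinder f → ∫ η, exclGen p f η ∂M = 0)
    {κ : ℝ} (hκ : 0 < κ) (hgood : ∀ l r : ℤ, ∃ l' r', l' < l ∧ r < r' ∧ GoodBox ν κ l' r')
    {l r : ℤ} (h : GoodBox ν κ l r) {x : ℤ} (hx : l ≤ x) (hxr : x < r) (η : ℤ → Bool) :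
    dens M ν (Finset.Icc l r) (swapConfig x (x + 1) η) = dens M ν (Finset.Icc l r) η := by
  have h0 := h.energy_eq_zero hp hp1 hnn hπ hbal hν hM hpos hinv hκ hgood
  rw [energy, Finset.sum_eq_zero_iff_of_nonneg fun x _ => prodn_nonneg hp hM hpos _ _] at h0
  have h1 := h0 x (by simp; omega)
  rw [prodn, exForm, mul_eq_zero, or_iff_right (hpp x).ne',
    ← integral_indicator (measurableSet_twoSite _ _ _ _)] at h1
  have hxF : x ∈ Finset.Icc l r := by simp; omega
  have hxF' : x + 1 ∈ Finset.Icc l r := by simp; omega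
  have dF := depOn_dens M ν (Finset.Icc l r)
  have h2 := DepOn.eq_zero_of_integral_eq_zero hpos
    ((dF.comp₂ (dF.swap hxF hxF') fun a b => (a - b) * (Real.log a - Real.log b)).indicator
      (depOn_twoSite hxF hxF' true false))
    (fun η => Set.indicator_nonneg (fun η _ =>
      sub_mul_log_sub_nonneg (dens_pos hM hpos _ _) (dens_pos hM hpos _ _)) η) h1
  have h3 : ∀ η ∈ twoSite x (x + 1) true false,
      dens M ν (Finset.Icc l r) (swapConfig x (x + 1) η) = dens M ν (Finset.Icc l r) η := by
    intro η hη
    have := h2 η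
    rw [Set.indicator_of_mem hη] at this
    exact (eq_of_sub_mul_log_sub_eq_zero (dens_pos hM hpos _ _) (dens_pos hM hpos _ _) this).symm
  by_cases e : η x = η (x + 1)
  · congr 1
    ext u
    unfold swapConfig
    split_ifs with h1 h2 <;> simp_all
  · cases hb : η x
    · have hb' : η (x + 1) = true := by
        cases hc : η (x + 1) <;> simp_all
      have := h3 (swapConfig x (x + 1) η) ⟨by simpa using hb', by simpa using hb⟩
      rw [swapConfig_swapConfig] at this
      exact this.symm
    · refine h3 η ⟨hb, ?_⟩
      cases hc : η (x + 1) <;> simp_all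

end

lemma swap_invariant_of_succ {β : Type*} {g : (ℤ → Bool) → β} {l r : ℤ}
    (h : ∀ x, l ≤ x → x < r → ∀ η, g (swapConfig x (x + 1) η) = g η) {y z : ℤ}
    (hy : l ≤ y) (hyz : y < z) (hz : z ≤ r) (η : ℤ → Bool) : g (swapConfig y z η) = g η := by
  induction z, (show y + 1 ≤ z by omega) using Int.leInduction generalizing η with
  | base => exact h y hy (by omega) η
  | succ z hyz' ih =>
    have e : swapConfig y (z + 1) η =
        swapConfig z (z + 1) (swapConfig y z (swapConfig z (z + 1) η)) := by
      ext u
      have n1 : y ≠ z := by omega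
      have n2 : y ≠ z + 1 := by omega
      have n3 : z + 1 ≠ y := by omega
      have n4 : z ≠ y := by omega
      simp only [swapConfig]
      split_ifs <;> first | rfl | omega | simp_all
    rw [e, h z (by omega) (by omega), ih (by omega) (by omega), h z (by omega) (by omega)]

/-- If all boxes are contained in boxes with uniformly non-degenerate boundary densities, every
invariant measure satisfies the swap relation. -/
theorem ExclInvariant.swapBal [IsFiniteMeasure ν] (hp : ∀ x y, 0 ≤ p x y) (hp1 : ∀ x y, p x y ≤ 1)
    (hnn : ∀ x y : ℤ, |x - y| ≠ 1 → p x y = 0) (hpp : ∀ x, 0 < p x (x + 1))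
    (hπ : ∀ x, 0 < π x) (hbal : ∀ x y, π x * p x y = π y * p y x) (hν : SwapBal π ν)
    (hinvν : ∀ f : (ℤ → Bool) → ℝ, IsCylinder f → ∫ η, exclGen p f η ∂ν = 0)
    (hpos : ∀ F a, 0 < ν.real (cyl F a))
    {κ : ℝ} (hκ : 0 < κ) (hgood : ∀ l r : ℤ, ∃ l' r', l' < l ∧ r < r' ∧ GoodBox ν κ l' r')
    {μ : Measure (ℤ → Bool)} (hμ : ExclInvariant p μ) : SwapBal π μ := by
  have := hμ.1
  have hMpos : ∀ F a, 0 < (μ + ν).real (cyl F a) := fun F a => by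
    rw [measureReal_add_apply]
    exact add_pos_of_nonneg_of_pos measureReal_nonneg (hpos F a)
  have hinv : ∀ f : (ℤ → Bool) → ℝ, IsCylinder f → ∫ η, exclGen p f η ∂(μ + ν) = 0 := by
    rintro f ⟨F, hF⟩
    obtain ⟨n, hn⟩ := exists_Icc F
    have hF : DepOn F f := hF
    have hf := hF.mono (hn (-|n|) |n| (by have := neg_abs_le n; grind) (le_abs_self n))
    have dG : ∀ x ∈ Finset.Ico (-|n| - 1) (|n| + 1),
        DepOn (Finset.Icc (-|n| - 1) (|n| + 1)) (bond p f x) := fun x hx => by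
      rw [Finset.mem_Ico] at hx
      exact (hf.mono (Icc_subset_succ _ _)).bond (by simp; omega) (by simp; omega)
    have e : exclGen p f = fun η => ∑ x ∈ Finset.Ico (-|n| - 1) (|n| + 1), bond p f x η :=
      funext fun η => exclGen_eq_sum_bond hnn hf η
    have hi : ∀ ρ : Measure (ℤ → Bool), IsFiniteMeasure ρ → Integrable (exclGen p f) ρ := by
      intro ρ hρ
      rw [e]
      exact integrable_finsetSum _ fun x hx => (dG x hx).integrable ρ
    rw [integral_add_measure (hi μ inferInstance) (hi ν inferInstance), hμ.2 f ⟨F, hF⟩,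
      hinvν f ⟨F, hF⟩, add_zero]
  have dens_add : ∀ F η, dens (μ + ν) ν F η = dens μ ν F η + 1 := fun F η => by
    unfold dens
    rw [measureReal_add_apply, add_div, div_self (hpos F η).ne']
  refine swapBal_of_cyl fun y z hyz => ⟨{y, z}, fun F hF a => ?_⟩
  obtain ⟨n, hn⟩ := exists_Icc F
  obtain ⟨l, r, hl, hr, hg⟩ := hgood (-|n|) |n|
  have hsub := hn l r (by have := le_abs_self n; omega) (by have := le_abs_self n; omega)
  have hyF : y ∈ Finset.Icc l r := hsub (hF (by simp))
  have hzF : z ∈ Finset.Icc l r := hsub (hF (by simp))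
  have hsucc : ∀ x, l ≤ x → x < r → ∀ η,
      dens μ ν (Finset.Icc l r) (swapConfig x (x + 1) η) = dens μ ν (Finset.Icc l r) η := by
    intro x hx hx' η
    have := hg.dens_swap_succ hp hp1 hnn hpp hπ hbal hν hMpos hpos hinv hκ hgood hx hx' η
    rw [dens_add, dens_add] at this
    linarith
  have hswap : ∀ η,
      dens μ ν (Finset.Icc l r) (swapConfig y z η) = dens μ ν (Finset.Icc l r) η := by
    rw [Finset.mem_Icc] at hyF hzF
    rcases hyz.lt_or_gt with h | h
    · exact swap_invariant_of_succ hsucc hyF.1 h hzF.2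
    · intro η
      rw [swapConfig_comm]
      exact swap_invariant_of_succ hsucc hzF.1 h hyF.2 η
  set C := cyl F a with hC
  have mC : MeasurableSet C := measurableSet_cyl F a
  have dC : DepOn (Finset.Icc l r) (C.indicator fun _ => (1 : ℝ)) :=
    DepOn.indicator (fun _ _ _ => rfl) ((depOn_cyl F a).mono hsub)
  have dD := depOn_dens μ ν (Finset.Icc l r)
  have h1 : ∀ b c, μ.real (C ∩ twoSite y z b c) =
      ∫ η in twoSite y z b c, C.indicator (fun _ => (1 : ℝ)) η ∂μ := fun b c => by
    rw [setIntegral_indicator mC, setIntegral_const, smul_eq_mul, mul_one, Set.inter_comm]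
  have h2 : μ.real (swapConfig y z ⁻¹' C ∩ twoSite y z true false) =
      ∫ η in twoSite y z true false, C.indicator (fun _ => (1 : ℝ)) (swapConfig y z η) ∂μ := by
    have e : (fun η => C.indicator (fun _ => (1 : ℝ)) (swapConfig y z η)) =
        (swapConfig y z ⁻¹' C).indicator fun _ => (1 : ℝ) := rfl
    rw [e, setIntegral_indicator (measurable_swapConfig y z mC), setIntegral_const, smul_eq_mul,
      mul_one, Set.inter_comm]
  have key : π z * μ.real (swapConfig y z ⁻¹' C ∩ twoSite y z true false) =
      π y * μ.real (C ∩ twoSite y z false true) := by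
    rw [h1, h2, ← setIntegral_mul_dens hpos dC hyF hzF,
      ← setIntegral_mul_dens hpos (dC.swap hyF hzF) hyF hzF,
      ← hν.integral hπ hyz (dC.comp₂ dD (· * ·)).measurable]
    simp only [hswap]
  rw [← ENNReal.ofReal_toReal (measure_ne_top μ (swapConfig y z ⁻¹' C ∩ _)),
    ← ENNReal.ofReal_toReal (measure_ne_top μ (C ∩ _)), ← ENNReal.ofReal_mul (hπ z).le,
    ← ENNReal.ofReal_mul (hπ y).le]
  exact congrArg _ key

end Stationary

lemma cyl_insert (y : ℤ) (F : Finset ℤ) (a : ℤ → Bool) :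
    cyl (insert y F) a = cyl F a ∩ {η | η y = a y} := by
  ext η
  simp [cyl, and_comm]

lemma exists_isBernoulliProduct {α : ℤ → ℝ} (h0 : ∀ x, 0 ≤ α x) (h1 : ∀ x, α x ≤ 1) :
    ∃ ν : Measure (ℤ → Bool), IsBernoulliProduct ν α := by
  let m : ℤ → Measure Bool := fun x =>
    ENNReal.ofReal (α x) • Measure.dirac true + ENNReal.ofReal (1 - α x) • Measure.dirac false
  have hm : ∀ x, IsProbabilityMeasure (m x) := fun x => ⟨by
    simp only [m, Measure.add_apply, Measure.smul_apply, measure_univ, smul_eq_mul, mul_one]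
    rw [← ENNReal.ofReal_add (h0 x) (sub_nonneg.2 (h1 x))]
    simp⟩
  refine ⟨Measure.infinitePi m, inferInstance, fun F a => ?_⟩
  have e : {η : ℤ → Bool | ∀ x ∈ F, η x = a x} = Set.pi F fun x => {a x} := by
    ext η; simp [Set.pi]
  rw [e, Measure.infinitePi_pi (μ := m) fun _ _ => measurableSet_singleton _]
  refine Finset.prod_congr rfl fun x _ => ?_
  cases h : a x <;> simp [m]

section Bernoulli

variable {ν : Measure (ℤ → Bool)} {α : ℤ → ℝ}

lemma _root_.IsBernoulliProduct.real_cyl (h : IsBernoulliProduct ν α) (h0 : ∀ x, 0 ≤ α x)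
    (h1 : ∀ x, α x ≤ 1) (F : Finset ℤ) (a : ℤ → Bool) :
    ν.real (cyl F a) = ∏ x ∈ F, if a x then α x else 1 - α x := by
  have := h.2 F a
  rw [measureReal_def, cyl, this, ENNReal.toReal_prod]
  refine Finset.prod_congr rfl fun x _ => ENNReal.toReal_ofReal ?_
  have := h0 x
  have := h1 x
  split_ifs <;> linarith

lemma _root_.IsBernoulliProduct.real_cyl_pos (h : IsBernoulliProduct ν α) (h0 : ∀ x, 0 < α x)
    (h1 : ∀ x, α x < 1) (F : Finset ℤ) (a : ℤ → Bool) : 0 < ν.real (cyl F a) := by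
  rw [h.real_cyl (fun x => (h0 x).le) fun x => (h1 x).le]
  refine Finset.prod_pos fun x _ => ?_
  have := h0 x
  have := h1 x
  split_ifs <;> linarith

lemma _root_.IsBernoulliProduct.goodBox (h : IsBernoulliProduct ν α) (h0 : ∀ x, 0 ≤ α x)
    (h1 : ∀ x, α x ≤ 1) {β : ℝ} (hβ : 0 < β) {l r : ℤ} (hlr : l ≤ r)
    (hl : β ≤ α (l - 1) ∧ α (l - 1) ≤ 1 - β) (hr : β ≤ α (r + 1) ∧ α (r + 1) ≤ 1 - β) :
    GoodBox ν (β * β) l r := by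
  refine ⟨hlr, fun a => ?_⟩
  have e : Finset.Icc (l - 1) (r + 1) = insert (l - 1) (insert (r + 1) (Finset.Icc l r)) := by
    ext x; simp only [Finset.mem_Icc, Finset.mem_insert]; omega
  have hP : 0 ≤ ∏ x ∈ Finset.Icc l r, (if a x then α x else 1 - α x) :=
    Finset.prod_nonneg fun x _ => by
      have := h0 x
      have := h1 x
      split_ifs <;> linarith
  rw [h.real_cyl h0 h1, h.real_cyl h0 h1, e, Finset.prod_insert (by simp; omega),
    Finset.prod_insert (by simp), ← mul_assoc]
  refine mul_le_mul_of_nonneg_right (mul_le_mul ?_ ?_ hβ.le ?_) hP <;> split_ifs <;> linarith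

lemma _root_.IsBernoulliProduct.swapBal {π : ℤ → ℝ} {c : ℝ} (hπ : ∀ x, 0 < π x) (hc : 0 < c)
    (h : IsBernoulliProduct ν fun x => c * π x / (1 + c * π x)) : SwapBal π ν := by
  have := h.1
  refine swapBal_of_cyl fun y z hyz => ⟨{y, z}, fun F hF a => ?_⟩
  have hy : y ∈ F := hF (by simp)
  have hz : z ∈ F := hF (by simp)
  by_cases ha : a y = false ∧ a z = true
  · have e1 : swapConfig y z ⁻¹' cyl F a ∩ twoSite y z true false =
        cyl F (swapConfig y z a) := by
      ext η
      constructor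
      · rintro ⟨h1, -⟩ u hu
        by_cases huy : u = y
        · subst huy; simpa using h1 z hz
        by_cases huz : u = z
        · subst huz; simpa using h1 y hy
        rw [swapConfig_of_ne huy huz]
        simpa [swapConfig_of_ne huy huz] using h1 u hu
      · intro h1
        refine ⟨fun u hu => ?_, ?_, ?_⟩
        · by_cases huy : u = y
          · subst huy; simpa using h1 z hz
          by_cases huz : u = z
          · subst huz; simpa using h1 y hy
          simpa [swapConfig_of_ne huy huz] using h1 u hu
        · simpa [ha.2] using h1 y hy
        · simpa [ha.1] using h1 z hz
    have e2 : cyl F a ∩ twoSite y z false true = cyl F a :=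
      Set.inter_eq_left.2 fun η hη => ⟨(hη y hy).trans ha.1, (hη z hz).trans ha.2⟩
    have hFe : F = insert y (insert z ((F.erase y).erase z)) := by
      ext u; simp only [Finset.mem_insert, Finset.mem_erase]; grind
    have n1 : z ∉ (F.erase y).erase z := by simp
    have n2 : y ∉ insert z ((F.erase y).erase z) := by simp [hyz]
    rw [e1, e2, cyl, cyl, h.2, h.2, hFe, Finset.prod_insert n2, Finset.prod_insert n1,
      Finset.prod_insert n2, Finset.prod_insert n1]
    have e3 : ∏ x ∈ (F.erase y).erase z, ENNReal.ofReal (if swapConfig y z a x = true then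
        c * π x / (1 + c * π x) else 1 - c * π x / (1 + c * π x)) =
        ∏ x ∈ (F.erase y).erase z, ENNReal.ofReal (if a x = true then
        c * π x / (1 + c * π x) else 1 - c * π x / (1 + c * π x)) :=
      Finset.prod_congr rfl fun x hx => by
        simp only [Finset.mem_erase] at hx
        rw [swapConfig_of_ne hx.2.1 hx.1]
    rw [e3]
    simp only [swapConfig_left, swapConfig_right, ha.1, ha.2]
    have k : ∀ x, 1 - c * π x / (1 + c * π x) = 1 / (1 + c * π x) := fun x => by
      have := hπ x
      have : 0 < c * π x := by positivity
      field_simp; ring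
    have hy0 := hπ y
    have hz0 := hπ z
    simp only [k, if_true, Bool.false_eq_true, if_false, ← mul_assoc]
    rw [← ENNReal.ofReal_mul hz0.le, ← ENNReal.ofReal_mul (by positivity),
      ← ENNReal.ofReal_mul hy0.le, ← ENNReal.ofReal_mul (by positivity)]
    congr 2
    field_simp
  · have e1 : swapConfig y z ⁻¹' cyl F a ∩ twoSite y z true false = ∅ := by
      rw [Set.eq_empty_iff_forall_notMem]
      rintro η ⟨h1, h2, h3⟩
      refine ha ⟨?_, ?_⟩
      · rw [← h1 y hy, swapConfig_left, h3]
      · rw [← h1 z hz, swapConfig_right, h2]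
    have e2 : cyl F a ∩ twoSite y z false true = ∅ := by
      rw [Set.eq_empty_iff_forall_notMem]
      rintro η ⟨h1, h2, h3⟩
      exact ha ⟨(h1 y hy).symm.trans h2, (h1 z hz).symm.trans h3⟩
    rw [e1, e2]
    simp

end Bernoulli

lemma real_inter_add_real_inter (μ : Measure (ℤ → Bool)) [IsFiniteMeasure μ]
    (A : Set (ℤ → Bool)) (y : ℤ) :
    μ.real (A ∩ {η | η y = true}) + μ.real (A ∩ {η | η y = false}) = μ.real A := by
  have e : A ∩ {η | η y = false} = A \ {η | η y = true} := by ext η; simp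
  rw [e, measureReal_inter_add_sdiff (measurableSet_site y true)]

/-- A probability measure whose conditional odds at each site are those of a product measure is
that product measure. -/
lemma isBernoulliProduct_of_odds {μ : Measure (ℤ → Bool)} [IsProbabilityMeasure μ] {π : ℤ → ℝ}
    {c : ℝ} (hπ : ∀ x, 0 < π x) (hc : 0 < c)
    (h : ∀ F y a, y ∉ F → μ.real (cyl F a ∩ {η | η y = true}) =
      c * π y * μ.real (cyl F a ∩ {η | η y = false})) :
    IsBernoulliProduct μ fun x => c * π x / (1 + c * π x) := by
  refine ⟨inferInstance, fun F a => ?_⟩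
  change μ (cyl F a) = _
  induction F using Finset.induction_on with
  | empty => simp [cyl]
  | insert y F hy ih =>
    rw [Finset.prod_insert hy, ← ih, cyl_insert]
    have h1 := h F y a hy
    have h2 := real_inter_add_real_inter μ (cyl F a) y
    have hp := hπ y
    have hq : 0 < 1 + c * π y := by positivity
    rw [← ENNReal.ofReal_toReal (measure_ne_top μ (cyl F a ∩ _)),
      ← ENNReal.ofReal_toReal (measure_ne_top μ (cyl F a))]
    change ENNReal.ofReal (μ.real _) = _ * ENNReal.ofReal (μ.real _)
    cases hb : a y
    · have k : 1 - c * π y / (1 + c * π y) = 1 / (1 + c * π y) := by field_simp; ring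
      simp only [Bool.false_eq_true, if_false]
      rw [k, ← ENNReal.ofReal_mul (by positivity), ← h2, h1]
      congr 1
      field_simp
      ring
    · simp only [if_true]
      rw [← ENNReal.ofReal_mul (by positivity), ← h2, h1]
      congr 1
      field_simp
      ring

lemma IsBernoulliProduct.unique {μ ν : Measure (ℤ → Bool)} {α : ℤ → ℝ}
    (hμ : IsBernoulliProduct μ α) (hν : IsBernoulliProduct ν α) : μ = ν := by
  have := hμ.1
  exact ext_of_cyl ∅ fun F _ a => (hμ.2 F a).trans (hν.2 F a).symm

/-- The centred occupation variable at `x`. -/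
noncomputable def centred (α : ℤ → ℝ) (x : ℤ) (η : ℤ → Bool) : ℝ :=
  (if η x then 1 else 0) - α x

lemma depOn_centred (α : ℤ → ℝ) {F : Finset ℤ} {x : ℤ} (hx : x ∈ F) :
    DepOn F (centred α x) :=
  (depOn_eval hx).comp fun b : Bool => (if b then (1 : ℝ) else 0) - α x

section

variable {ν : Measure (ℤ → Bool)} {α : ℤ → ℝ}

lemma integral_occ_mul (h : IsBernoulliProduct ν α) (h0 : ∀ x, 0 ≤ α x)
    (h1 : ∀ x, α x ≤ 1) {x y : ℤ} (hxy : x ≠ y) :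
    ∫ η : ℤ → Bool, (if η x then (1 : ℝ) else 0) * (if η y then 1 else 0) ∂ν = α x * α y := by
  have e : (fun η : ℤ → Bool => (if η x then (1 : ℝ) else 0) * (if η y then 1 else 0)) =
      (cyl {x, y} fun _ => true).indicator fun _ => 1 := by
    ext η
    by_cases hx : η x <;> by_cases hy : η y <;> simp [cyl, Set.indicator, hx, hy]
  rw [e, integral_indicator (measurableSet_cyl _ _), setIntegral_const, smul_eq_mul, mul_one,
    h.real_cyl h0 h1, Finset.prod_pair hxy]
  simp

lemma integral_occ (h : IsBernoulliProduct ν α) (h0 : ∀ x, 0 ≤ α x)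
    (h1 : ∀ x, α x ≤ 1) (x : ℤ) :
    ∫ η : ℤ → Bool, (if η x then (1 : ℝ) else 0) ∂ν = α x := by
  have e : (fun η : ℤ → Bool => (if η x then (1 : ℝ) else 0)) =
      (cyl {x} fun _ => true).indicator fun _ => 1 := by
    ext η
    by_cases hx : η x <;> simp [cyl, Set.indicator, hx]
  rw [e, integral_indicator (measurableSet_cyl _ _), setIntegral_const, smul_eq_mul, mul_one,
    h.real_cyl h0 h1]
  simp

lemma integral_centred_mul (h : IsBernoulliProduct ν α) (h0 : ∀ x, 0 ≤ α x)
    (h1 : ∀ x, α x ≤ 1) {x y : ℤ} (hxy : x ≠ y) :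
    ∫ η, centred α x η * centred α y η ∂ν = 0 := by
  have := h.1
  have dx : DepOn {x, y} (fun η : ℤ → Bool => (if η x then (1 : ℝ) else 0)) :=
    (depOn_eval (by simp)).comp fun b : Bool => if b then (1 : ℝ) else 0
  have dy : DepOn {x, y} (fun η : ℤ → Bool => (if η y then (1 : ℝ) else 0)) :=
    (depOn_eval (by simp)).comp fun b : Bool => if b then (1 : ℝ) else 0
  have i1 := (dx.comp₂ dy (· * ·)).integrable ν
  have i2 := ((dx.integrable ν).const_mul (α y))
  have i3 := ((dy.integrable ν).const_mul (α x))
  have e : (fun η => centred α x η * centred α y η) = fun η : ℤ → Bool =>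
      (if η x then (1 : ℝ) else 0) * (if η y then 1 else 0) - α y * (if η x then (1 : ℝ) else 0) -
        α x * (if η y then (1 : ℝ) else 0) + α x * α y := by
    ext η; unfold centred; ring
  have i12 : Integrable (fun η : ℤ → Bool => (if η x then (1 : ℝ) else 0) *
      (if η y then 1 else 0) - α y * (if η x then (1 : ℝ) else 0)) ν := i1.sub i2
  have i123 : Integrable (fun η : ℤ → Bool => (if η x then (1 : ℝ) else 0) *
      (if η y then 1 else 0) - α y * (if η x then (1 : ℝ) else 0) -
      α x * (if η y then (1 : ℝ) else 0)) ν := i12.sub i3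
  rw [e, integral_add i123 (integrable_const _), integral_sub i12 i3,
    integral_sub i1 i2, integral_const_mul, integral_const_mul, integral_occ_mul h h0 h1 hxy,
    integral_occ h h0 h1, integral_occ h h0 h1]
  simp
  ring

lemma integral_sum_centred_sq_le (h : IsBernoulliProduct ν α) (h0 : ∀ x, 0 ≤ α x)
    (h1 : ∀ x, α x ≤ 1) (I : Finset ℤ) {w : ℤ → ℝ} {W : ℝ} (hw : ∀ x ∈ I, |w x| ≤ W) :
    ∫ η, (∑ x ∈ I, w x * centred α x η) ^ 2 ∂ν ≤ I.card * W ^ 2 := by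
  have := h.1
  have e : (fun η => (∑ x ∈ I, w x * centred α x η) ^ 2) = fun η =>
      ∑ x ∈ I, ∑ y ∈ I, w x * w y * (centred α x η * centred α y η) := by
    ext η
    rw [sq, Finset.sum_mul_sum]
    exact Finset.sum_congr rfl fun x _ => Finset.sum_congr rfl fun y _ => by ring
  have hi : ∀ x ∈ I, ∀ y ∈ I,
      Integrable (fun η => w x * w y * (centred α x η * centred α y η)) ν := fun x hx y hy =>
    (((depOn_centred α hx).comp₂ (depOn_centred α hy) (· * ·)).integrable ν).const_mul _
  rw [e, integral_finsetSum _ fun x hx => integrable_finsetSum _ fun y hy => hi x hx y hy]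
  rw [← nsmul_eq_mul]
  refine Finset.sum_le_card_nsmul _ _ _ fun x hx => ?_
  rw [integral_finsetSum _ fun y hy => hi x hx y hy, Finset.sum_eq_single_of_mem x hx]
  · rw [integral_const_mul]
    have hv : ∫ η, centred α x η * centred α x η ∂ν ≤ 1 := by
      calc _ ≤ ∫ η, (1 : ℝ) ∂ν := by
            refine integral_mono (((depOn_centred α hx).comp₂ (depOn_centred α hx)
              (· * ·)).integrable ν) (integrable_const _) fun η => ?_
            have := h0 x
            have := h1 x
            simp only [centred]
            split_ifs <;> nlinarith
        _ = 1 := by simp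
    have hW : w x * w x ≤ W ^ 2 := by
      rw [← abs_mul_abs_self, sq]
      exact mul_self_le_mul_self (abs_nonneg _) (hw x hx)
    have hv0 : 0 ≤ ∫ η, centred α x η * centred α x η ∂ν :=
      integral_nonneg fun η => mul_self_nonneg _
    nlinarith [mul_self_nonneg (w x)]
  · intro y hy hyx
    rw [integral_const_mul, integral_centred_mul h h0 h1 hyx.symm, mul_zero]

lemma integral_abs_sum_centred_le (h : IsBernoulliProduct ν α) (h0 : ∀ x, 0 ≤ α x)
    (h1 : ∀ x, α x ≤ 1) {ρ : Measure (ℤ → Bool)} [IsFiniteMeasure ρ] {K : ℝ} (hK : 0 ≤ K)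
    (hρ : ρ ≤ ENNReal.ofReal K • ν) (I : Finset ℤ) {w : ℤ → ℝ} {W : ℝ} (hw : ∀ x ∈ I, |w x| ≤ W)
    {ε : ℝ} (hε : 0 < ε) :
    ∫ η, |∑ x ∈ I, w x * centred α x η| ∂ρ ≤ K * ((ε * (I.card * W ^ 2) + 1 / ε) / 2) := by
  have := h.1
  have dS : DepOn I fun η => ∑ x ∈ I, w x * centred α x η := fun η ξ hηξ =>
    Finset.sum_congr rfl fun x hx => by rw [depOn_centred α hx η ξ hηξ]
  have iq := (dS.comp fun s => (ε * s ^ 2 + 1 / ε) / 2).integrable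
  have iK := (iq ν).smul_measure (c := ENNReal.ofReal K) ENNReal.ofReal_ne_top
  calc ∫ η, |∑ x ∈ I, w x * centred α x η| ∂ρ
      ≤ ∫ η, (ε * (∑ x ∈ I, w x * centred α x η) ^ 2 + 1 / ε) / 2 ∂ρ := by
        refine integral_mono ((dS.comp fun s => |s|).integrable ρ) (iq ρ) fun η => ?_
        simp only
        set s := ∑ x ∈ I, w x * centred α x η
        have k : ε * s ^ 2 + 1 / ε - 2 * |s| = ε * (|s| - 1 / ε) ^ 2 := by
          rw [← sq_abs s]; field_simp; ring
        nlinarith [mul_nonneg hε.le (sq_nonneg (|s| - 1 / ε))]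
    _ ≤ ∫ η, (ε * (∑ x ∈ I, w x * centred α x η) ^ 2 + 1 / ε) / 2 ∂(ENNReal.ofReal K • ν) :=
        integral_mono_measure hρ (Eventually.of_forall fun η => by positivity) iK
    _ = K * ((ε * ∫ η, (∑ x ∈ I, w x * centred α x η) ^ 2 ∂ν + 1 / ε) / 2) := by
        rw [integral_smul_measure, ENNReal.toReal_ofReal hK, integral_div,
          integral_add (((dS.comp fun s => s ^ 2).integrable ν).const_mul ε) (integrable_const _),
          integral_const_mul]
        simp
    _ ≤ _ := by
        have := integral_sum_centred_sq_le h h0 h1 I hw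
        gcongr

end

/-- The conditional odds at a site, computed from the occupation of a distant site. -/
lemma SwapBal.odds_sub_eq {π : ℤ → ℝ} (hπ : ∀ x, 0 < π x) {ρ : Measure (ℤ → Bool)}
    [IsFiniteMeasure ρ] (hρ : SwapBal π ρ) {c : ℝ} (hc : 0 < c) {F : Finset ℤ} {y x : ℤ}
    (a : ℤ → Bool) (hy : y ∉ F) (hx : x ∉ F) (hxy : x ≠ y) :
    ρ.real (cyl F a ∩ {η | η y = true}) - c * π y * ρ.real (cyl F a ∩ {η | η y = false}) =
      ∫ η in cyl F a ∩ {η | η y = true},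
        (1 + c * π x) * centred (fun x => c * π x / (1 + c * π x)) x η ∂ρ +
      ∫ η in cyl F a ∩ {η | η y = false},
        (1 + c * π x) * (π y / π x) * centred (fun x => c * π x / (1 + c * π x)) x η ∂ρ := by
  have hπx := hπ x
  have hπy := hπ y
  have h1 := hρ.apply hxy.symm (measurableSet_cyl F a)
  have e : swapConfig y x ⁻¹' cyl F a = cyl F a := by
    ext η
    exact ((depOn_cyl F a).swap_eq hy hx η).to_iff
  rw [e] at h1
  have h2 := congrArg ENNReal.toReal h1
  rw [ENNReal.toReal_mul, ENNReal.toReal_mul, ENNReal.toReal_ofReal (hπ x).le,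
    ENNReal.toReal_ofReal (hπ y).le] at h2
  change π x * ρ.real _ = π y * ρ.real _ at h2
  have h3 : ∀ b, ∫ η in cyl F a ∩ {η | η y = b},
      centred (fun x => c * π x / (1 + c * π x)) x η ∂ρ =
      ρ.real (cyl F a ∩ twoSite y x b true) -
        c * π x / (1 + c * π x) * ρ.real (cyl F a ∩ {η | η y = b}) := by
    intro b
    have eI : (fun η : ℤ → Bool => if η x then (1 : ℝ) else 0) =
        {η : ℤ → Bool | η x = true}.indicator fun _ => 1 := by
      ext η; by_cases h : η x <;> simp [h]
    unfold centred
    have d : DepOn {x} fun η : ℤ → Bool => if η x then (1 : ℝ) else 0 :=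
      (depOn_eval (by simp)).comp fun b : Bool => if b then (1 : ℝ) else 0
    rw [integral_sub (d.integrable _) (integrable_const _), eI,
      setIntegral_indicator (measurableSet_site x true), setIntegral_const, setIntegral_const,
      smul_eq_mul, smul_eq_mul, mul_one, mul_comm (ρ.real _) (_ / _), Set.inter_assoc]
    rfl
  have h4 : ρ.real (cyl F a ∩ twoSite y x true true) + ρ.real (cyl F a ∩ twoSite y x true false) =
      ρ.real (cyl F a ∩ {η | η y = true}) := by
    have := real_inter_add_real_inter ρ (cyl F a ∩ {η | η y = true}) x
    rw [Set.inter_assoc, Set.inter_assoc] at this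
    exact this
  rw [integral_const_mul, integral_const_mul, h3, h3]
  set A := ρ.real (cyl F a ∩ {η | η y = true})
  set B := ρ.real (cyl F a ∩ {η | η y = false})
  have h5 : ρ.real (cyl F a ∩ twoSite y x false true) =
      π x / π y * (A - ρ.real (cyl F a ∩ twoSite y x true true)) := by
    rw [← h4]
    field_simp
    linarith
  rw [h5]
  have : 0 < 1 + c * π x := by positivity
  field_simp
  ring

lemma SwapBal.odds_of_le {π : ℤ → ℝ} (hπ : ∀ x, 0 < π x) {ν ρ : Measure (ℤ → Bool)}
    [IsFiniteMeasure ρ] (hρ : SwapBal π ρ) {c : ℝ} (hc : 0 < c)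
    (hν : IsBernoulliProduct ν fun x => c * π x / (1 + c * π x)) {K : ℝ} (hK : 0 ≤ K)
    (hle : ρ ≤ ENNReal.ofReal K • ν) {a₀ b₀ : ℝ} (ha₀ : 0 < a₀)
    (hinf : {x : ℤ | a₀ ≤ π x ∧ π x ≤ b₀}.Infinite) {F : Finset ℤ} {y : ℤ} (a : ℤ → Bool)
    (hy : y ∉ F) :
    ρ.real (cyl F a ∩ {η | η y = true}) = c * π y * ρ.real (cyl F a ∩ {η | η y = false}) := by
  set α : ℤ → ℝ := fun x => c * π x / (1 + c * π x) with hα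
  have h0 : ∀ x, 0 ≤ α x := fun x => by have := hπ x; simp only [hα]; positivity
  have h1 : ∀ x, α x ≤ 1 := fun x => by
    have := hπ x
    simp only [hα]
    rw [div_le_one (by positivity)]
    linarith
  have hb₀ : 0 < b₀ := by
    obtain ⟨x, hx⟩ := hinf.nonempty
    exact ha₀.trans_le (hx.1.trans hx.2)
  set W := (1 + c * b₀) * (1 + π y / a₀) with hW
  have hπy := hπ y
  have hW0 : 0 < W := by positivity
  set D := ρ.real (cyl F a ∩ {η | η y = true}) - c * π y * ρ.real (cyl F a ∩ {η | η y = false})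
    with hD
  have key : ∀ N : ℕ, ∀ ε > 0, N * |D| ≤ K * (ε * (N * W ^ 2) + 1 / ε) := by
    intro N ε hε
    obtain ⟨I, hI, hcard⟩ := (hinf.sdiff (insert y F).finite_toSet).exists_subset_card_eq N
    have hIx : ∀ x ∈ I, (a₀ ≤ π x ∧ π x ≤ b₀) ∧ x ≠ y ∧ x ∉ F := fun x hx => by
      have := hI hx
      simpa [not_or] using this
    have bd : ∀ w : ℤ → ℝ, (∀ x ∈ I, |w x| ≤ W) → ∀ s : Set (ℤ → Bool),
        |∑ x ∈ I, ∫ η in s, w x * centred α x η ∂ρ| ≤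
          K * ((ε * (N * W ^ 2) + 1 / ε) / 2) := by
      intro w hw s
      have dS : DepOn I fun η => ∑ x ∈ I, w x * centred α x η := fun η ξ hηξ =>
        Finset.sum_congr rfl fun x hx => by rw [depOn_centred α hx η ξ hηξ]
      rw [← integral_finsetSum _ fun x hx =>
        ((depOn_centred α hx).integrable _).const_mul _, ← hcard]
      calc _ ≤ ∫ η in s, |∑ x ∈ I, w x * centred α x η| ∂ρ := abs_integral_le_integral_abs
        _ ≤ ∫ η, |∑ x ∈ I, w x * centred α x η| ∂ρ :=
          setIntegral_le_integral ((dS.comp fun s => |s|).integrable ρ)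
            (Eventually.of_forall fun η => abs_nonneg _)
        _ ≤ _ := integral_abs_sum_centred_le hν h0 h1 hK hle I hw hε
    have hsum : N * D = ∑ x ∈ I, ∫ η in cyl F a ∩ {η | η y = true},
        (1 + c * π x) * centred α x η ∂ρ + ∑ x ∈ I, ∫ η in cyl F a ∩ {η | η y = false},
        (1 + c * π x) * (π y / π x) * centred α x η ∂ρ := by
      rw [← Finset.sum_add_distrib, ← hcard, ← nsmul_eq_mul, ← Finset.sum_const]
      exact Finset.sum_congr rfl fun x hx =>
        hρ.odds_sub_eq hπ hc a hy (hIx x hx).2.2 (hIx x hx).2.1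
    have q1 : ∀ x ∈ I, 1 + c * π x ≤ 1 + c * b₀ := fun x hx => by
      have := (hIx x hx).1.2
      gcongr
    have q2 : ∀ x ∈ I, π y / π x ≤ π y / a₀ := fun x hx => by
      have := (hIx x hx).1.1
      gcongr
    have r0 : 0 ≤ π y / a₀ := by positivity
    have b1 := bd (fun x => 1 + c * π x) (fun x hx => by
      have := hπ x
      rw [abs_of_pos (by positivity), hW]
      refine (q1 x hx).trans (le_mul_of_one_le_right (by positivity) (by linarith)))
      (cyl F a ∩ {η | η y = true})
    have b2 := bd (fun x => (1 + c * π x) * (π y / π x)) (fun x hx => by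
      have := hπ x
      rw [abs_of_pos (by positivity), hW]
      exact mul_le_mul (q1 x hx) ((q2 x hx).trans (by linarith)) (by positivity) (by positivity))
      (cyl F a ∩ {η | η y = false})
    calc N * |D| = |N * D| := by rw [abs_mul, Nat.abs_cast]
      _ ≤ _ := by
        rw [hsum]
        refine (abs_add_le _ _).trans ?_
        linarith
  have hlim : ∀ ε > 0, |D| ≤ K * (ε * W ^ 2) := by
    intro ε hε
    refine le_of_forall_pos_le_add fun e he => ?_
    obtain ⟨N, hN⟩ := exists_nat_gt (K * (1 / ε) / e)
    have hN0 : (0 : ℝ) < N := lt_of_le_of_lt (by positivity) hN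
    rw [div_lt_iff₀ he] at hN
    refine le_of_mul_le_mul_left ?_ hN0
    calc _ ≤ _ := key N ε hε
      _ ≤ _ := by nlinarith
  have hD0 : |D| ≤ 0 := by
    refine le_of_forall_pos_le_add fun e he => ?_
    refine (hlim (e / (K * W ^ 2 + 1)) (by positivity)).trans ?_
    rw [zero_add, ← mul_assoc, mul_div_assoc', div_mul_eq_mul_div, div_le_iff₀ (by positivity)]
    nlinarith
  have : D = 0 := abs_nonpos_iff.1 hD0
  linarith

lemma exists_gt_of_infinite {s : Set ℤ} (hs : s.Infinite) (h0 : ∀ x ∈ s, 0 < x) (R : ℤ) :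
    ∃ x ∈ s, R < x := by
  by_contra! h
  exact hs ((Set.finite_Ioc 0 R).subset fun x hx => ⟨h0 x hx, h x hx⟩)

lemma exists_lt_of_infinite {s : Set ℤ} (hs : s.Infinite) (h0 : ∀ x ∈ s, x < 0) (R : ℤ) :
    ∃ x ∈ s, x < R := by
  by_contra! h
  exact hs ((Set.finite_Ico R 0).subset fun x hx => ⟨h x hx, h0 x hx⟩)

section

variable {p : ℤ → ℤ → ℝ} {π : ℤ → ℝ}

/-- Under two-sided limit points of the reversible measure, every invariant measure satisfies the
swap relation. -/
theorem swapBal_of_limit_points (hp : IsTransition p)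
    (hnn : ∀ x y : ℤ, |x - y| ≠ 1 → p x y = 0)
    (hinf : ∃ δ : ℝ, 0 < δ ∧ ∀ x y : ℤ, |x - y| = 1 → δ ≤ p x y)
    (hrev : IsReversible p π)
    (hplus : ∃ L : ℝ, 0 < L ∧ ∀ ε : ℝ, 0 < ε → {x : ℤ | 0 < x ∧ |π x - L| < ε}.Infinite)
    (hminus : ∃ L : ℝ, 0 < L ∧ ∀ ε : ℝ, 0 < ε → {x : ℤ | x < 0 ∧ |π x - L| < ε}.Infinite)
    {μ : Measure (ℤ → Bool)} (hμ : ExclInvariant p μ) : SwapBal π μ := by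
  obtain ⟨hπ, hbal⟩ := hrev
  obtain ⟨δ, hδ, hδp⟩ := hinf
  obtain ⟨L, hL, hLinf⟩ := hplus
  obtain ⟨L', hL', hLinf'⟩ := hminus
  have hp1 : ∀ x y, p x y ≤ 1 := fun x y => le_hasSum (hp.2.1 x) y fun z _ => hp.1 x z
  have hpp : ∀ x, 0 < p x (x + 1) := fun x => hδ.trans_le (hδp x (x + 1) (by simp))
  set α : ℤ → ℝ := fun x => 1 * π x / (1 + 1 * π x) with hα
  have h0 : ∀ x, 0 < α x := fun x => by have := hπ x; simp only [hα]; positivity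
  have h1 : ∀ x, α x < 1 := fun x => by
    have := hπ x
    simp only [hα]
    rw [div_lt_one (by positivity)]
    linarith
  obtain ⟨ν, hν⟩ := exists_isBernoulliProduct (fun x => (h0 x).le) fun x => (h1 x).le
  have := hν.1
  have hswap : SwapBal π ν := hν.swapBal hπ one_pos
  have near : ∀ {l x : ℝ}, 0 < l → |x - l| < l / 2 → min l 1 / (2 * (1 + 2 * l)) ≤
      1 * x / (1 + 1 * x) ∧ 1 * x / (1 + 1 * x) ≤ 1 - min l 1 / (2 * (1 + 2 * l)) := by
    intro l x hl hx
    rw [abs_lt] at hx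
    have hx0 : 0 < x := by linarith
    have hm1 : min l 1 ≤ l := min_le_left _ _
    have hm2 : min l 1 ≤ 1 := min_le_right _ _
    have hm0 : 0 < min l 1 := lt_min hl one_pos
    have e : 1 * x / (1 + 1 * x) = 1 - 1 / (1 + x) := by field_simp; ring
    constructor
    · rw [div_le_div_iff₀ (by positivity) (by positivity)]
      nlinarith
    · rw [e]
      have : min l 1 / (2 * (1 + 2 * l)) ≤ 1 / (1 + x) := by
        rw [div_le_div_iff₀ (by positivity) (by positivity)]
        nlinarith
      linarith
  set β := min (min L 1 / (2 * (1 + 2 * L))) (min L' 1 / (2 * (1 + 2 * L'))) with hβ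
  have hβ0 : 0 < β := by
    have : 0 < min L 1 := lt_min hL one_pos
    have : 0 < min L' 1 := lt_min hL' one_pos
    exact lt_min (by positivity) (by positivity)
  refine Exclusion.ExclInvariant.swapBal hp.1 hp1 hnn hpp hπ hbal hswap
    (hswap.exclInvariant hnn hπ hbal).2 (hν.real_cyl_pos h0 h1) (mul_pos hβ0 hβ0) ?_ hμ
  intro l r
  obtain ⟨x, ⟨hx0, hx⟩, hxr⟩ :=
    exists_gt_of_infinite (hLinf (L / 2) (by positivity)) (fun x hx => hx.1) (max r 0 + 1)
  obtain ⟨z, ⟨hz0, hz⟩, hzl⟩ :=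
    exists_lt_of_infinite (hLinf' (L' / 2) (by positivity)) (fun x hx => hx.1) (min l 0 - 1)
  refine ⟨z + 1, x - 1, by omega, by omega,
    hν.goodBox (fun x => (h0 x).le) (fun x => (h1 x).le) hβ0 (by omega) ?_ ?_⟩
  · rw [add_sub_cancel_right]
    have := near hL' hz
    have hle : β ≤ _ := min_le_right _ _
    exact ⟨hle.trans this.1, this.2.trans (by linarith)⟩
  · rw [sub_add_cancel]
    have := near hL hx
    have hle : β ≤ _ := min_le_left _ _
    exact ⟨hle.trans this.1, this.2.trans (by linarith)⟩

lemma le_smul_of_eq_add {μ ν₁ ν₂ : Measure (ℤ → Bool)} {s : ENNReal} {t : ℝ} (ht : 0 < t)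
    (h : μ = ENNReal.ofReal t • ν₁ + s • ν₂) : ν₁ ≤ ENNReal.ofReal t⁻¹ • μ := by
  refine Measure.le_iff.2 fun A _ => ?_
  rw [h, Measure.smul_apply, Measure.add_apply, Measure.smul_apply, smul_eq_mul, smul_eq_mul,
    mul_add, ← mul_assoc, ← ENNReal.ofReal_mul (by positivity), inv_mul_cancel₀ ht.ne']
  simp

lemma isExtremalInvariant_of_le {μ : Measure (ℤ → Bool)} (hμ : ExclInvariant p μ)
    (h : ∀ (K : ℝ) (ρ : Measure (ℤ → Bool)), 0 ≤ K → ExclInvariant p ρ →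
      ρ ≤ ENNReal.ofReal K • μ → ρ = μ) : IsExtremalInvariant p μ := by
  refine ⟨hμ, fun t ν₁ ν₂ ht ht' h₁ h₂ hdec => ⟨?_, ?_⟩⟩
  · exact h _ ν₁ (by positivity) h₁ (le_smul_of_eq_add ht hdec)
  · rw [add_comm] at hdec
    have : 0 < 1 - t := by linarith
    exact h _ ν₂ (by positivity) h₂ (le_smul_of_eq_add this hdec)

lemma exclGen_const (p : ℤ → ℤ → ℝ) (f : (ℤ → Bool) → ℝ) (b : Bool) :
    exclGen p f (fun _ => b) = 0 := by
  cases b <;> simp [exclGen]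

lemma eq_dirac_of_compl {ρ : Measure (ℤ → Bool)} [IsProbabilityMeasure ρ] {a : ℤ → Bool}
    (h : ρ {a}ᶜ = 0) : ρ = Measure.dirac a := by
  have h1 : ρ.restrict {a} = ρ := Measure.restrict_eq_self_of_ae_mem h
  have h2 : ρ {a} = 1 := (prob_compl_eq_zero_iff (measurableSet_singleton a)).1 h
  rw [← h1, Measure.restrict_singleton, h2, one_smul]

lemma isExtremalInvariant_dirac (p : ℤ → ℤ → ℝ) (b : Bool) :
    IsExtremalInvariant p (Measure.dirac fun _ : ℤ => b) := by
  refine isExtremalInvariant_of_le ⟨inferInstance, fun f _ => ?_⟩ fun K ρ _ hρ hle => ?_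
  · rw [integral_dirac, exclGen_const]
  · have := hρ.1
    refine eq_dirac_of_compl (le_antisymm ((hle _).trans ?_) zero_le)
    simp

theorem isExtremalInvariant_of_isBernoulliProduct (hnn : ∀ x y : ℤ, |x - y| ≠ 1 → p x y = 0)
    (hrev : IsReversible p π)
    (hplus : ∃ L : ℝ, 0 < L ∧ ∀ ε : ℝ, 0 < ε → {x : ℤ | 0 < x ∧ |π x - L| < ε}.Infinite)
    (hswap : ∀ μ, ExclInvariant p μ → SwapBal π μ)
    {c : ℝ} (hc : 0 < c) {μ : Measure (ℤ → Bool)}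
    (hμ : IsBernoulliProduct μ fun x => c * π x / (1 + c * π x)) : IsExtremalInvariant p μ := by
  obtain ⟨hπ, hbal⟩ := hrev
  obtain ⟨L, hL, hLinf⟩ := hplus
  have := hμ.1
  refine isExtremalInvariant_of_le ((hμ.swapBal hπ hc).exclInvariant hnn hπ hbal)
    fun K ρ hK hρ hle => ?_
  have := hρ.1
  have hinf : {x : ℤ | L / 2 ≤ π x ∧ π x ≤ 2 * L}.Infinite :=
    (hLinf (L / 2) (by positivity)).mono fun x hx => by
      have := abs_lt.1 hx.2
      constructor <;> linarith
  exact Exclusion.IsBernoulliProduct.unique (isBernoulliProduct_of_odds hπ hc fun F y a hy =>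
    (hswap ρ hρ).odds_of_le hπ hc hμ hK hle (by positivity) hinf a hy) hμ

end

/-- Limits along an ultrafilter of the traces of a finite measure on a sequence of sets form a
measure. -/
lemma exists_limit_measure {Ω : Type*} [MeasurableSpace Ω] (μ : Measure Ω) [IsFiniteMeasure μ]
    (𝒰 : Ultrafilter ℕ) (s : ℕ → Set Ω) (hs : ∀ n, MeasurableSet (s n)) :
    ∃ m : Measure Ω, m ≤ μ ∧
      ∀ A, MeasurableSet A → Tendsto (fun n => μ (A ∩ s n)) 𝒰 (𝓝 (m A)) := by
  set g : Set Ω → ENNReal := fun A => (𝒰.map fun n => μ (A ∩ s n)).lim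
  have hg : ∀ A, Tendsto (fun n => μ (A ∩ s n)) 𝒰 (𝓝 (g A)) := fun A =>
    (𝒰.map fun n => μ (A ∩ s n)).le_nhds_lim
  have hle : ∀ A, g A ≤ μ A := fun A =>
    le_of_tendsto' (hg A) fun n => measure_mono Set.inter_subset_left
  have htop : ∀ A, g A ≠ ⊤ := fun A => ((hle A).trans_lt (measure_lt_top μ A)).ne
  have hgr : ∀ A, Tendsto (fun n => μ.real (A ∩ s n)) 𝒰 (𝓝 (g A).toReal) := fun A =>
    (ENNReal.tendsto_toReal (htop A)).comp (hg A)
  refine ⟨Measure.ofMeasurable (fun A _ => g A) (le_antisymm ((hle ∅).trans (by simp)) zero_le)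
    fun A hA hd => ?_, ?_, ?_⟩
  · have hfin : ∑' i, μ (A i) ≠ ⊤ := by
      rw [← measure_iUnion hd hA]; exact measure_ne_top _ _
    have hfin' : ∑' i, g (A i) ≠ ⊤ :=
      ((ENNReal.tsum_le_tsum fun i => hle (A i)).trans_lt hfin.lt_top).ne
    rw [← ENNReal.toReal_eq_toReal_iff' (htop _) hfin', ENNReal.tsum_toReal_eq fun i => htop _]
    refine tendsto_nhds_unique (hgr _) ?_
    have e : ∀ n, μ.real ((⋃ i, A i) ∩ s n) = ∑' i, μ.real (A i ∩ s n) := fun n => by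
      rw [Set.iUnion_inter, measureReal_def, measure_iUnion
        (fun i j hij => (hd hij).mono Set.inter_subset_left Set.inter_subset_left)
        fun i => (hA i).inter (hs n), ENNReal.tsum_toReal_eq fun i => measure_ne_top _ _]
      rfl
    simp only [e]
    refine tendsto_tsum_of_dominated_convergence (bound := fun i => μ.real (A i))
      (ENNReal.summable_toReal hfin) (fun i => hgr (A i)) (Eventually.of_forall fun n i => ?_)
    rw [Real.norm_of_nonneg measureReal_nonneg]
    exact measureReal_mono Set.inter_subset_left
  · refine Measure.le_iff.2 fun A hA => ?_
    rw [Measure.ofMeasurable_apply A hA]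
    exact hle A
  · intro A hA
    rw [Measure.ofMeasurable_apply A hA]
    exact hg A

section

variable {π : ℤ → ℝ} {μ : Measure (ℤ → Bool)}

lemma SwapBal.smul (h : SwapBal π μ) (k : ENNReal) : SwapBal π (k • μ) := by
  intro y z hyz
  rw [Measure.restrict_smul, Measure.restrict_smul, Measure.map_smul, smul_comm, h y z hyz,
    smul_comm]

lemma SwapBal.of_limit [IsFiniteMeasure μ] (h : SwapBal π μ) {𝒰 : Ultrafilter ℕ} {x : ℕ → ℤ}
    (hx : ∀ y, ∀ᶠ n in 𝒰, x n ≠ y) (b : Bool) {m : Measure (ℤ → Bool)} (hle : m ≤ μ)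
    (hm : ∀ A, MeasurableSet A →
      Tendsto (fun n => μ (A ∩ {η | η (x n) = b})) 𝒰 (𝓝 (m A))) : SwapBal π m := by
  have : IsFiniteMeasure m := isFiniteMeasure_of_le μ hle
  refine swapBal_of_cyl fun y z hyz => ⟨∅, fun F _ a => ?_⟩
  have mC := measurableSet_cyl F a
  have t1 := ENNReal.Tendsto.const_mul (a := ENNReal.ofReal (π z))
    (hm _ ((measurable_swapConfig y z mC).inter (measurableSet_twoSite y z true false)))
    (Or.inr ENNReal.ofReal_ne_top)
  have t2 := ENNReal.Tendsto.const_mul (a := ENNReal.ofReal (π y))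
    (hm _ (mC.inter (measurableSet_twoSite y z false true))) (Or.inr ENNReal.ofReal_ne_top)
  refine tendsto_nhds_unique_of_eventuallyEq t1 t2 ?_
  filter_upwards [hx y, hx z] with n hy hz
  have := h.apply hyz (mC.inter (measurableSet_site (x n) b))
  rw [Set.preimage_inter] at this
  have e : swapConfig y z ⁻¹' {η | η (x n) = b} = {η | η (x n) = b} := by
    ext η
    change swapConfig y z η (x n) = b ↔ η (x n) = b
    rw [swapConfig_of_ne hy hz]
  rw [e] at this
  rw [Set.inter_right_comm, this, Set.inter_right_comm]

lemma SwapBal.limit_odds [IsFiniteMeasure μ] (h : SwapBal π μ) (hπ : ∀ x, 0 < π x)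
    {𝒰 : Ultrafilter ℕ} {x : ℕ → ℤ}
    (hx : ∀ y, ∀ᶠ n in 𝒰, x n ≠ y) {L : ℝ}
    (hxL : Tendsto (fun n => π (x n)) 𝒰 (𝓝 L)) {m : Bool → Measure (ℤ → Bool)}
    (hle : ∀ b, m b ≤ μ)
    (hm : ∀ b A, MeasurableSet A →
      Tendsto (fun n => μ (A ∩ {η | η (x n) = b})) 𝒰 (𝓝 (m b A)))
    {F : Finset ℤ} {y : ℤ} (a : ℤ → Bool) (hy : y ∉ F) :
    L * (m false).real (cyl F a ∩ {η | η y = true}) =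
      π y * (m true).real (cyl F a ∩ {η | η y = false}) := by
  have mC := measurableSet_cyl F a
  have fin : ∀ b s, m b s ≠ ⊤ := fun b s => ((hle b s).trans_lt (measure_lt_top μ s)).ne
  have t : ∀ b c, Tendsto (fun n => μ.real ((cyl F a ∩ {η | η y = c}) ∩ {η | η (x n) = b})) 𝒰
      (𝓝 ((m b).real (cyl F a ∩ {η | η y = c}))) := fun b c =>
    (ENNReal.tendsto_toReal (fin _ _)).comp (hm b _ (mC.inter (measurableSet_site y c)))
  refine tendsto_nhds_unique_of_eventuallyEq (hxL.mul (t false true))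
    ((t true false).const_mul (π y)) ?_
  have hF : ∀ᶠ n in 𝒰, ∀ z ∈ F, x n ≠ z := (Finset.eventually_all F).2 fun z _ => hx z
  filter_upwards [hx y, hF] with n hxy hxF
  have hxF' : x n ∉ F := fun h => hxF _ h rfl
  have h1 := h.apply hxy.symm mC
  have e : swapConfig y (x n) ⁻¹' cyl F a = cyl F a := by
    ext η
    exact ((depOn_cyl F a).swap_eq hy hxF' η).to_iff
  rw [e] at h1
  have h2 := congrArg ENNReal.toReal h1
  rw [ENNReal.toReal_mul, ENNReal.toReal_mul, ENNReal.toReal_ofReal (hπ _).le,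
    ENNReal.toReal_ofReal (hπ y).le] at h2
  rw [Set.inter_assoc, Set.inter_assoc]
  exact h2

lemma eq_dirac_of_site [IsProbabilityMeasure μ] (b : Bool) (h : ∀ y, μ {η | η y = !b} = 0) :
    μ = Measure.dirac fun _ => b := by
  refine eq_dirac_of_compl (measure_mono_null (t := ⋃ y, {η | η y = !b}) ?_
    (measure_iUnion_null h))
  intro η hη
  have hη : η ≠ fun _ => b := hη
  obtain ⟨y, hy⟩ := Function.ne_iff.1 hη
  exact Set.mem_iUnion.2 ⟨y, by cases b <;> simp_all⟩

theorem IsExtremalInvariant.eq_dirac_or_isBernoulliProduct {p : ℤ → ℤ → ℝ}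
    (hnn : ∀ x y : ℤ, |x - y| ≠ 1 → p x y = 0) (hrev : IsReversible p π)
    (hplus : ∃ L : ℝ, 0 < L ∧ ∀ ε : ℝ, 0 < ε → {x : ℤ | 0 < x ∧ |π x - L| < ε}.Infinite)
    (hswap : ∀ μ, ExclInvariant p μ → SwapBal π μ) (hμ : IsExtremalInvariant p μ) :
    μ = Measure.dirac (fun _ : ℤ => false) ∨ μ = Measure.dirac (fun _ : ℤ => true) ∨
      ∃ c : ℝ, 0 < c ∧ IsBernoulliProduct μ (fun x => c * π x / (1 + c * π x)) := by
  obtain ⟨hπ, hbal⟩ := hrev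
  obtain ⟨L, hL, hLinf⟩ := hplus
  have := hμ.1.1
  have hb := hswap μ hμ.1
  choose x hx hxgt using fun n : ℕ => exists_gt_of_infinite
    (hLinf (1 / ((n : ℝ) + 1)) (by positivity)) (fun x hx => hx.1) (n : ℤ)
  set 𝒰 : Ultrafilter ℕ := hyperfilter ℕ
  have hU : (𝒰 : Filter ℕ) ≤ atTop := Nat.hyperfilter_le_atTop
  have hxne : ∀ y, ∀ᶠ n in 𝒰, x n ≠ y := fun y => by
    refine hU ?_
    filter_upwards [eventually_ge_atTop y.toNat] with n hn
    have := hxgt n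
    omega
  have hxL : Tendsto (fun n => π (x n)) 𝒰 (𝓝 L) := by
    refine Tendsto.mono_left ?_ hU
    rw [tendsto_iff_dist_tendsto_zero]
    exact squeeze_zero (fun _ => dist_nonneg) (fun n => (hx n).2.le)
      tendsto_one_div_add_atTop_nhds_zero_nat
  choose m hle hm using fun b => exists_limit_measure μ 𝒰 (fun n => {η | η (x n) = b})
    fun n => measurableSet_site (x n) b
  have fin : ∀ b, IsFiniteMeasure (m b) := fun b => isFiniteMeasure_of_le μ (hle b)
  have hmb : ∀ b, SwapBal π (m b) := fun b => hb.of_limit hxne b (hle b) (hm b)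
  have hadd : μ = m true + m false := by
    ext A hA
    rw [Measure.add_apply]
    refine tendsto_nhds_unique ?_ ((hm true A hA).add (hm false A hA))
    refine tendsto_const_nhds.congr fun n => ?_
    have e : A ∩ {η | η (x n) = false} = A \ {η | η (x n) = true} := by ext η; simp
    rw [e, measure_inter_add_sdiff A (measurableSet_site (x n) true)]
  have hodds := fun F y a hy => hb.limit_odds hπ hxne hxL hle hm (F := F) (y := y) a hy
  have hcyl : ∀ s, cyl ∅ (fun _ => true) ∩ s = s := fun s => by
    rw [Set.inter_eq_right]; intro η _; simp [cyl]
  set θ := (m true).real Set.univ with hθ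
  have hθ1 : (m false).real Set.univ = 1 - θ := by
    have : μ.real Set.univ = (m true + m false).real Set.univ := by rw [← hadd]
    rw [probReal_univ, measureReal_add_apply] at this
    linarith
  rcases (measureReal_nonneg : 0 ≤ θ).eq_or_lt with h0 | h0
  · left
    have hz : m true = 0 := by
      rw [← Measure.measure_univ_eq_zero]
      exact (measureReal_eq_zero_iff).1 h0.symm
    rw [hz, zero_add] at hadd
    refine eq_dirac_of_site false fun y => ?_
    have := hodds ∅ y (fun _ => true) (by simp)
    rw [hcyl, hcyl, hz, ← hadd] at this
    simp only [measureReal_zero, Pi.zero_apply, mul_zero, mul_eq_zero, hL.ne', false_or] at this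
    simpa using (measureReal_eq_zero_iff).1 this
  right
  rcases (measureReal_nonneg : 0 ≤ (m false).real Set.univ).eq_or_lt with h1 | h1
  · left
    have hz : m false = 0 := by
      rw [← Measure.measure_univ_eq_zero]
      exact (measureReal_eq_zero_iff).1 h1.symm
    rw [hz, add_zero] at hadd
    refine eq_dirac_of_site true fun y => ?_
    have := hodds ∅ y (fun _ => true) (by simp)
    rw [hcyl, hcyl, hz, ← hadd] at this
    simp only [measureReal_zero, Pi.zero_apply, mul_zero, zero_eq_mul, (hπ y).ne', false_or] at this
    simpa using (measureReal_eq_zero_iff).1 this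
  right
  rw [hθ1] at h1
  have inv : ∀ (b : Bool) (t : ℝ), (m b).real Set.univ = t → 0 < t →
      ExclInvariant p (ENNReal.ofReal t⁻¹ • m b) := by
    intro b t ht ht0
    have : IsProbabilityMeasure (ENNReal.ofReal t⁻¹ • m b) := ⟨by
      rw [Measure.smul_apply, smul_eq_mul,
        ← ENNReal.ofReal_toReal (measure_ne_top (m b) Set.univ)]
      change _ * ENNReal.ofReal ((m b).real Set.univ) = 1
      rw [ht, ← ENNReal.ofReal_mul (by positivity), inv_mul_cancel₀ ht0.ne', ENNReal.ofReal_one]⟩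
    exact ((hmb b).smul _).exclInvariant hnn hπ hbal
  have cancel : ∀ (b : Bool) (t : ℝ), 0 < t →
      ENNReal.ofReal t • ENNReal.ofReal t⁻¹ • m b = m b := fun b t ht => by
    rw [smul_smul, ← ENNReal.ofReal_mul ht.le, mul_inv_cancel₀ ht.ne', ENNReal.ofReal_one,
      one_smul]
  obtain ⟨e1, e2⟩ := hμ.2 θ _ _ h0 (by linarith) (inv true θ rfl h0) (inv false (1 - θ) hθ1 h1)
    (by rw [cancel _ _ h0, cancel _ _ h1]; exact hadd)
  have k1 : m true = ENNReal.ofReal θ • μ := by rw [← cancel true θ h0, e1]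
  have k2 : m false = ENNReal.ofReal (1 - θ) • μ := by rw [← cancel false _ h1, e2]
  refine ⟨θ / ((1 - θ) * L), by positivity, isBernoulliProduct_of_odds hπ (by positivity)
    fun F y a hy => ?_⟩
  have := hodds F y a hy
  rw [k1, k2, measureReal_ennreal_smul_apply, measureReal_ennreal_smul_apply,
    ENNReal.toReal_ofReal h0.le, ENNReal.toReal_ofReal h1.le] at this
  field_simp
  linarith

end

end Exclusion


/-- For a nearest-neighbor kernel on `ℤ` with rates bounded below, if the
reversible measure `π` has a finite nonzero limit point along `x → +∞` and along `x → -∞`,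
then the extremal invariant measures are exactly `{ν^c : 0 ≤ c ≤ ∞}`. -/
theorem extremal_set_eq_reversible_of_limit_points
    (p : ℤ → ℤ → ℝ) (π : ℤ → ℝ) (hp : IsTransition p)
    (hnn : ∀ x y : ℤ, |x - y| ≠ 1 → p x y = 0)
    (hinf : ∃ δ : ℝ, 0 < δ ∧ ∀ x y : ℤ, |x - y| = 1 → δ ≤ p x y)
    (hrev : IsReversible p π)
    (hplus : ∃ L : ℝ, 0 < L ∧ ∀ ε : ℝ, 0 < ε → {x : ℤ | 0 < x ∧ |π x - L| < ε}.Infinite)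
    (hminus : ∃ L : ℝ, 0 < L ∧ ∀ ε : ℝ, 0 < ε → {x : ℤ | x < 0 ∧ |π x - L| < ε}.Infinite) :
    ∀ μ : Measure (ℤ → Bool), IsExtremalInvariant p μ ↔
      (μ = Measure.dirac (fun _ : ℤ => false) ∨ μ = Measure.dirac (fun _ : ℤ => true) ∨
        ∃ c : ℝ, 0 < c ∧ IsBernoulliProduct μ (fun x => c * π x / (1 + c * π x))) := by
  have hswap : ∀ ρ : Measure (ℤ → Bool), ExclInvariant p ρ → Exclusion.SwapBal π ρ := fun ρ hρ =>
    Exclusion.swapBal_of_limit_points hp hnn hinf hrev hplus hminus hρ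
  refine fun μ => ⟨fun h =>
    Exclusion.IsExtremalInvariant.eq_dirac_or_isBernoulliProduct hnn hrev hplus hswap h, ?_⟩
  rintro (rfl | rfl | ⟨c, hc, hμ⟩)
  · exact Exclusion.isExtremalInvariant_dirac p false
  · exact Exclusion.isExtremalInvariant_dirac p true
  · exact Exclusion.isExtremalInvariant_of_isBernoulliProduct hnn hrev hplus hswap hc hμ
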